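/- arXiv:2409.02896 — 13 statements merged into one kernel-verified Lean document; each statement's English description precedes it below -/
import Mathlib

section
/- Let X be a standard Borel space and E a countable Borel equivalence relation on X. Then there exists a sequence (g_n : X → X)_{n ∈ ℕ} of Borel involutions (Borel functions with g_n ∘ g_n = id) such that for all x, y ∈ X: E x y if and only if there exists n with g_n x = y. (Feldman–Moore theorem, strong form: every CBER is the union of the graphs of countably many Borel involutions.) -/
open Set TopologicalSpace MeasureTheory

/-- A set is covered by countably many Borel sets on each of which `φ` is injective. -/
def IsSigmaInjOn {Z X : Type*} [MeasurableSpace Z] (φ : Z → X) (S : Set Z) : Prop :=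
  ∃ B : ℕ → Set Z, (∀ n, MeasurableSet (B n) ∧ InjOn φ (B n)) ∧ S ⊆ ⋃ n, B n

namespace IsSigmaInjOn

variable {Z X : Type*} [MeasurableSpace Z] {φ : Z → X}

lemma mono {S T : Set Z} (hT : IsSigmaInjOn φ T) (h : S ⊆ T) : IsSigmaInjOn φ S :=
  let ⟨B, hB, hTB⟩ := hT
  ⟨B, hB, h.trans hTB⟩

lemma of_injOn {S : Set Z} (hS : MeasurableSet S) (h : InjOn φ S) : IsSigmaInjOn φ S :=
  ⟨fun _ => S, fun _ => ⟨hS, h⟩, (iUnion_const S).ge⟩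

lemma empty : IsSigmaInjOn φ (∅ : Set Z) :=
  of_injOn MeasurableSet.empty (injOn_empty φ)

lemma iUnion {κ : Type*} [Countable κ] {S : κ → Set Z} (h : ∀ k, IsSigmaInjOn φ (S k)) :
    IsSigmaInjOn φ (⋃ k, S k) := by
  cases isEmpty_or_nonempty κ
  · simpa using empty
  choose B hB hSB using h
  obtain ⟨e, he⟩ := exists_surjective_nat (κ × ℕ)
  refine ⟨fun n => B (e n).1 (e n).2, fun n => hB _ _, iUnion_subset fun k z hz => ?_⟩
  obtain ⟨m, hm⟩ := mem_iUnion.1 (hSB k hz)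
  obtain ⟨n, hn⟩ := he (k, m)
  exact mem_iUnion.2 ⟨n, by simpa [hn] using hm⟩

lemma exists_measurable_superset {S : Set Z} (h : IsSigmaInjOn φ S) :
    ∃ T, MeasurableSet T ∧ S ⊆ T ∧ IsSigmaInjOn φ T :=
  let ⟨B, hB, hSB⟩ := h
  ⟨⋃ n, B n, .iUnion fun n => (hB n).1, hSB, B, hB, subset_rfl⟩

end IsSigmaInjOn

/-- A family of subsets of `Z` is small if the base can be covered by Borel sets, one for each
member of the family, over which that member is `σ`-injective. -/
def IsSmallFamily {Z X ι : Type*} [MeasurableSpace Z] [MeasurableSpace X] (φ : Z → X)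
    (C : ι → Set Z) : Prop :=
  ∃ A : ι → Set X, (∀ i, MeasurableSet (A i)) ∧ (∀ x, ∃ i, x ∈ A i) ∧
    ∀ i, IsSigmaInjOn φ (C i ∩ φ ⁻¹' A i)

section Splitting

variable {Z X : Type*} [MeasurableSpace Z] [MeasurableSpace X] {φ : Z → X}

lemma nonempty_of_not_isSmallFamily {ι : Type*} {C : ι → Set Z}
    (h : ¬ IsSmallFamily φ C) (i : ι) : (C i).Nonempty := by
  by_contra hi
  rw [not_nonempty_iff_eq_empty] at hi
  refine h ⟨fun j => {_x | j = i}, fun j => .const _, fun x => ⟨i, rfl⟩, fun j => ?_⟩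
  refine IsSigmaInjOn.empty.mono ?_
  rintro z ⟨hz, rfl : j = i⟩
  simp [hi] at hz

variable [MetricSpace Z] [SecondCountableTopology Z] [BorelSpace Z]

/-- Every member of a family of open sets that is not small can be split into two disjoint small
open pieces so that the resulting family is still not small. -/
lemma exists_split_of_not_isSmallFamily (hφ : Measurable φ) {n : ℕ}
    {C : (Fin n → Bool) → Set Z} (hC : ∀ i, IsOpen (C i)) (h : ¬ IsSmallFamily φ C)
    {ε : ℝ} (hε : 0 < ε) :
    ∃ D : (Fin (n + 1) → Bool) → Set Z, (∀ t, IsOpen (D t)) ∧ ¬ IsSmallFamily φ D ∧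
      (∀ t, closure (D t) ⊆ C (Fin.init t)) ∧ (∀ t, ∀ a ∈ D t, ∀ b ∈ D t, dist a b < ε) ∧
      ∀ s t, Fin.init s = Fin.init t → s (Fin.last n) ≠ t (Fin.last n) →
        Disjoint (D s) (D t) := by
  let good (i : Fin n → Bool) (q : Bool → countableBasis Z) : Prop :=
    (∀ b, closure (q b : Set Z) ⊆ C i) ∧
    (∀ b, ∀ u ∈ (q b : Set Z), ∀ v ∈ (q b : Set Z), dist u v < ε) ∧
    Disjoint (q false : Set Z) (q true)
  let P (i : Fin n → Bool) := {q : Bool → countableBasis Z // good i q}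
  have : Countable (countableBasis Z) := (countable_countableBasis Z).to_subtype
  let D (p : ∀ i, P i) (t : Fin (n + 1) → Bool) : Set Z :=
    (p (Fin.init t)).1 (t (Fin.last n))
  by_cases hp : ∃ p, ¬ IsSmallFamily φ (D p)
  · obtain ⟨p, hp⟩ := hp
    refine ⟨D p, fun t => isOpen_of_mem_countableBasis (Subtype.prop _), hp,
      fun t => (p (Fin.init t)).2.1 _, fun t => (p (Fin.init t)).2.2.1 _, fun s t hst hne => ?_⟩
    have hd : ∀ i j, i = j → ∀ b c, b ≠ c → Disjoint ((p i).1 b : Set Z) ((p j).1 c) := by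
      rintro i _ rfl b c hbc
      have := (p i).2.2.2
      cases b <;> cases c <;> simp_all [this.symm]
    exact hd _ _ hst _ _ hne
  push Not at hp
  refine (h ?_).elim
  choose A hAm hAc hA using hp
  let A' (i : Fin n → Bool) : Set X :=
    ⋂ q : P i, ⋃ p : {p : ∀ j, P j // p i = q}, ⋃ b : Bool, A p.1 (Fin.snoc i b)
  refine ⟨A', fun i => .iInter fun q => .iUnion fun p => .iUnion fun b => hAm _ _, fun x => ?_,
    fun i => ?_⟩
  · by_contra! hx
    simp only [A', mem_iInter, not_forall] at hx
    choose q hq using hx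
    obtain ⟨t, ht⟩ := hAc q x
    refine hq (Fin.init t) (mem_iUnion₂.2 ⟨⟨q, rfl⟩, t (Fin.last n), ?_⟩)
    rwa [Fin.snoc_init_self]
  · let S (pb : (∀ j, P j) × Bool) : Set Z :=
      D pb.1 (Fin.snoc i pb.2) ∩ φ ⁻¹' A pb.1 (Fin.snoc i pb.2)
    obtain ⟨K, hKm, hSK, hK⟩ :=
      (IsSigmaInjOn.iUnion (S := S) fun pb => hA _ _).exists_measurable_superset
    have hA'm : MeasurableSet (A' i) :=
      .iInter fun q => .iUnion fun p => .iUnion fun b => hAm _ _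
    have hinj : InjOn φ ((C i ∩ φ ⁻¹' A' i) \ K) := by
      rintro z ⟨⟨hz, hzA⟩, hzK⟩ w ⟨⟨hw, -⟩, hwK⟩ hzw
      by_contra hne
      obtain ⟨U, V, hU, hV, hzU, hwV, hUV⟩ := t2_separation hne
      have key : ∀ (v : Z) (W : Set Z), IsOpen W → v ∈ W → v ∈ C i →
          ∃ T ∈ countableBasis Z, v ∈ T ∧ closure T ⊆ W ∩ C i ∩ Metric.ball v (ε / 2) :=
        fun v W hW hvW hvC => (isBasis_countableBasis Z).exists_closure_subset
          (((hW.inter (hC i)).inter Metric.isOpen_ball).mem_nhds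
            ⟨⟨hvW, hvC⟩, Metric.mem_ball_self (half_pos hε)⟩)
      have diam : ∀ (v : Z) (T : Set Z), T ⊆ Metric.ball v (ε / 2) →
          ∀ a ∈ T, ∀ b ∈ T, dist a b < ε := fun v T hT a ha b hb => by
        have h1 := Metric.mem_ball.1 (hT ha)
        have h2 := Metric.mem_ball.1 (hT hb)
        linarith [dist_triangle_right a b v]
      obtain ⟨U', hU'b, hzU', hU'⟩ := key z U hU hzU hz
      obtain ⟨V', hV'b, hwV', hV'⟩ := key w V hV hwV hw
      let q : P i := ⟨fun b => cond b ⟨V', hV'b⟩ ⟨U', hU'b⟩, by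
        refine ⟨?_, ?_, ?_⟩
        · rintro (_ | _)
          · exact hU'.trans fun _ h => h.1.2
          · exact hV'.trans fun _ h => h.1.2
        · rintro (_ | _)
          · exact diam z U' (subset_closure.trans (hU'.trans fun _ h => h.2))
          · exact diam w V' (subset_closure.trans (hV'.trans fun _ h => h.2))
        · exact hUV.mono (subset_closure.trans (hU'.trans fun _ h => h.1.1))
            (subset_closure.trans (hV'.trans fun _ h => h.1.1))⟩
      obtain ⟨⟨p, hpq⟩, b, hb⟩ := mem_iUnion₂.1 (mem_iInter.1 hzA q)
      have hpj : ∀ j c, j = i → c = b → ((p j).1 c : Set Z) = q.1 b := by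
        rintro j c rfl rfl
        rw [hpq]
      have hDq : D p (Fin.snoc i b) = (q.1 b : Set Z) :=
        hpj _ _ (Fin.init_snoc (α := fun _ => Bool) b i) (Fin.snoc_last (α := fun _ => Bool) b i)
      cases b
      · exact hzK (hSK (mem_iUnion.2 ⟨(p, false), by rw [hDq]; exact hzU', hb⟩))
      · exact hwK (hSK (mem_iUnion.2 ⟨(p, true), by rw [hDq]; exact hwV', by
          rw [mem_preimage, ← hzw]; exact hb⟩))
    have hrest := IsSigmaInjOn.of_injOn
      ((((hC i).measurableSet).inter (hφ hA'm)).diff hKm) hinj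
    refine (IsSigmaInjOn.iUnion (S := fun b : Bool => cond b K ((C i ∩ φ ⁻¹' A' i) \ K))
      (by rintro (_ | _) <;> assumption)).mono fun z hz => ?_
    by_cases hzK : z ∈ K
    · exact mem_iUnion.2 ⟨true, hzK⟩
    · exact mem_iUnion.2 ⟨false, hz, hzK⟩

end Splitting

lemma not_countable_nat_to_bool : ¬ Countable (ℕ → Bool) := fun h => by
  have : Countable (Set ℕ) := by
    classical
    exact Function.Injective.countable (f := fun (s : Set ℕ) (n : ℕ) => decide (n ∈ s))
      fun s t hst => by ext n; simpa using congrFun hst n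
  obtain ⟨f, hf⟩ := exists_surjective_nat (Set ℕ)
  exact Function.cantor_surjective f hf

/-- A continuous map with countable fibers on a Polish space is injective on
each piece of a countable Borel cover. -/
lemma isSigmaInjOn_univ_of_continuous {Z X : Type*} [TopologicalSpace Z] [PolishSpace Z]
    [MeasurableSpace Z] [BorelSpace Z] [TopologicalSpace X] [T2Space X] [MeasurableSpace X]
    [BorelSpace X] {φ : Z → X} (hφ : Continuous φ) (hfib : ∀ x, (φ ⁻¹' {x}).Countable) :
    IsSigmaInjOn φ (univ : Set Z) := by
  let := upgradeIsCompletelyMetrizable Z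
  by_contra huniv
  let State (n : ℕ) :=
    {C : (Fin n → Bool) → Set Z // (∀ i, IsOpen (C i)) ∧ ¬ IsSmallFamily φ C}
  have step : ∀ n (C : State n), ∃ D : State (n + 1),
      (∀ t, closure (D.1 t) ⊆ C.1 (Fin.init t)) ∧
      (∀ t, ∀ a ∈ D.1 t, ∀ b ∈ D.1 t, dist a b < (1 / 2) ^ n) ∧
      ∀ s t, Fin.init s = Fin.init t → s (Fin.last n) ≠ t (Fin.last n) →
        Disjoint (D.1 s) (D.1 t) := fun n C => by
    obtain ⟨D, hDo, hDs, h⟩ := exists_split_of_not_isSmallFamily hφ.measurable C.2.1 C.2.2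
      (ε := (1 / 2) ^ n) (by positivity)
    exact ⟨⟨D, hDo, hDs⟩, h⟩
  choose next hcl hdiam hdisj using step
  have hroot : ¬ IsSmallFamily φ (fun _ : Fin 0 → Bool => (univ : Set Z)) := by
    rintro ⟨A, -, hAc, hA⟩
    refine huniv ((hA default).mono fun z _ => ⟨trivial, ?_⟩)
    obtain ⟨i, hi⟩ := hAc (φ z)
    rwa [Subsingleton.elim i default] at hi
  let C (n : ℕ) : State n := Nat.rec ⟨fun _ => univ, fun _ => isOpen_univ, hroot⟩ next n
  let res (α : ℕ → Bool) (n : ℕ) : Fin n → Bool := fun k => α k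
  let T (α : ℕ → Bool) (n : ℕ) : Set Z := (C n).1 (res α n)
  have hT : ∀ α n, closure (T α (n + 1)) ⊆ T α n := fun α n => hcl n (C n) (res α (n + 1))
  have hTd : ∀ α n, ∀ a ∈ T α (n + 1), ∀ b ∈ T α (n + 1), dist a b < (1 / 2) ^ n :=
    fun α n => hdiam n (C n) (res α (n + 1))
  have hTanti : ∀ α, Antitone (T α) := fun α =>
    antitone_nat_of_succ_le fun n => subset_closure.trans (hT α n)
  have hTne : ∀ α n, (T α n).Nonempty := fun α n => nonempty_of_not_isSmallFamily (C n).2.2 _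
  have hlim : ∀ α, ∃ z, ∀ n, z ∈ T α n := fun α => by
    choose u hu using hTne α
    have hc : CauchySeq fun n => u (n + 1) := by
      refine cauchySeq_of_le_geometric (1 / 2) 1 (by norm_num) fun n => ?_
      rw [one_mul]
      exact (hTd α n _ (hu (n + 1)) _ (hTanti α (Nat.le_succ (n + 1)) (hu (n + 1 + 1)))).le
    obtain ⟨z, hz⟩ := cauchySeq_tendsto_of_complete hc
    refine ⟨z, fun n => hT α n (mem_closure_of_tendsto hz ?_)⟩
    filter_upwards [Filter.eventually_ge_atTop n] with k hk
    exact hTanti α (Nat.succ_le_succ hk) (hu (k + 1))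
  choose z hz using hlim
  have hzinj : Function.Injective z := fun α β h => by
    have hres : ∀ n, res α n = res β n := fun n => by
      induction n with
      | zero => exact Subsingleton.elim _ _
      | succ n ih =>
        by_contra hne
        have hlast : α n ≠ β n := fun heq => hne <| by
          rw [← Fin.snoc_init_self (res α (n + 1)), ← Fin.snoc_init_self (res β (n + 1))]
          exact congrArg₂ (Fin.snoc (α := fun _ => Bool)) ih heq
        have hd := hdisj n (C n) (res α (n + 1)) (res β (n + 1)) ih hlast
        exact disjoint_left.1 hd (hz α (n + 1)) (h ▸ hz β (n + 1))
    exact funext fun n => congrFun (hres (n + 1)) (Fin.last n)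
  have hnhds : ∀ α, ∀ O : Set X, IsOpen O → φ (z α) ∈ O → ∃ N, ∀ n ≥ N, T α n ⊆ φ ⁻¹' O :=
    fun α O hO hzO => by
      obtain ⟨ε, hε, hball⟩ := Metric.isOpen_iff.1 (hO.preimage hφ) _ hzO
      obtain ⟨N, hN⟩ := exists_pow_lt_of_lt_one hε (by norm_num : (1 / 2 : ℝ) < 1)
      exact ⟨N + 1, fun n hn a ha => hball
        ((hTd α N _ (hTanti α hn ha) _ (hz α (N + 1))).trans hN)⟩
  have hφz : ∀ α β, φ (z α) = φ (z β) := fun α β => by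
    by_contra hne
    obtain ⟨O, O', hO, hO', hα, hβ, hOO'⟩ := t2_separation hne
    obtain ⟨N, hN⟩ := hnhds α O hO hα
    obtain ⟨N', hN'⟩ := hnhds β O' hO' hβ
    let n := max N N'
    have h1 : T α n ⊆ φ ⁻¹' O := hN n (le_max_left _ _)
    have h2 : T β n ⊆ φ ⁻¹' O' := hN' n (le_max_right _ _)
    refine (C n).2.2 ⟨fun i => {x | (i = res α n ∧ x ∉ O) ∨ (i = res β n ∧ x ∉ O')},
      fun i => ?_, fun x => ?_, fun i => IsSigmaInjOn.empty.mono ?_⟩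
    · exact ((MeasurableSet.const _).inter hO.measurableSet.compl).union
        ((MeasurableSet.const _).inter hO'.measurableSet.compl)
    · by_cases hx : x ∈ O
      · exact ⟨_, Or.inr ⟨rfl, disjoint_left.1 hOO' hx⟩⟩
      · exact ⟨_, Or.inl ⟨rfl, hx⟩⟩
    · rintro w ⟨hw, ⟨rfl, hwO⟩ | ⟨rfl, hwO⟩⟩
      · exact hwO (h1 hw)
      · exact hwO (h2 hw)
  have hcount : (range z).Countable := (hfib (φ (z fun _ => false))).mono <| by
    rintro _ ⟨α, rfl⟩
    exact hφz _ _
  have : Countable (range z) := hcount.to_subtype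
  exact not_countable_nat_to_bool
    (Function.Injective.countable (rangeFactorization_injective.2 hzinj))

/-- **Lusin–Novikov**: a Borel map with countable fibers between standard Borel spaces is injective
on each piece of a countable Borel cover. -/
theorem Measurable.isSigmaInjOn_univ {Z X : Type*} [MeasurableSpace Z] [StandardBorelSpace Z]
    [MeasurableSpace X] [StandardBorelSpace X] {φ : Z → X} (hφ : Measurable φ)
    (hfib : ∀ x, (φ ⁻¹' {x}).Countable) : IsSigmaInjOn φ (univ : Set Z) := by
  let := upgradeStandardBorel X
  let := upgradeStandardBorel Z
  obtain ⟨t', t't, hcont, hpolish⟩ := hφ.exists_continuous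
  have hborel : @BorelSpace Z t' _ := ⟨by
    rw [eq_borel_upgradeStandardBorel Z]
    exact borel_eq_borel_of_le ‹_› inferInstance t't |>.symm⟩
  exact @isSigmaInjOn_univ_of_continuous Z X t' hpolish _ hborel _ _ _ _ φ hcont hfib

/-- A Borel set on which two Borel maps `u` and `v` are injective with disjoint images yields a
Borel involution exchanging `u z` and `v z`. -/
lemma exists_measurable_involution {Z X : Type*} [MeasurableSpace Z] [StandardBorelSpace Z]
    [MeasurableSpace X] [StandardBorelSpace X] {u v : Z → X} (hu : Measurable u)
    (hv : Measurable v) {F : Set Z} (hF : MeasurableSet F) (huF : InjOn u F) (hvF : InjOn v F)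
    (hdisj : Disjoint (u '' F) (v '' F)) :
    ∃ g : X → X, Measurable g ∧ g ∘ g = id ∧ (∀ z ∈ F, g (u z) = v z) ∧
      ∀ x, g x = x ∨ ∃ z ∈ F, (x = u z ∧ g x = v z) ∨ (x = v z ∧ g x = u z) := by
  classical
  let g (x : X) : X :=
    if h : x ∈ u '' F then v h.choose else if h : x ∈ v '' F then u h.choose else x
  have gu : ∀ z ∈ F, g (u z) = v z := fun z hz => by
    have h : u z ∈ u '' F := mem_image_of_mem u hz
    simp only [g, dif_pos h]
    rw [huF h.choose_spec.1 hz h.choose_spec.2]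
  have gv : ∀ z ∈ F, g (v z) = u z := fun z hz => by
    have h : v z ∈ v '' F := mem_image_of_mem v hz
    simp only [g, dif_neg (disjoint_right.1 hdisj h), dif_pos h]
    rw [hvF h.choose_spec.1 hz h.choose_spec.2]
  have gid : ∀ x, x ∉ u '' F → x ∉ v '' F → g x = x := fun x h h' => by
    simp only [g, dif_neg h, dif_neg h']
  have cases_g : ∀ x, g x = x ∨ ∃ z ∈ F, (x = u z ∧ g x = v z) ∨ (x = v z ∧ g x = u z) := by
    intro x
    by_cases h : x ∈ u '' F
    · obtain ⟨z, hz, rfl⟩ := h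
      exact .inr ⟨z, hz, .inl ⟨rfl, gu z hz⟩⟩
    by_cases h' : x ∈ v '' F
    · obtain ⟨z, hz, rfl⟩ := h'
      exact .inr ⟨z, hz, .inr ⟨rfl, gv z hz⟩⟩
    exact .inl (gid x h h')
  refine ⟨g, fun T hT => ?_, funext fun x => ?_, gu, cases_g⟩
  · have hpre : g ⁻¹' T = u '' (F ∩ v ⁻¹' T) ∪ v '' (F ∩ u ⁻¹' T) ∪
        (T \ (u '' F ∪ v '' F)) := by
      ext x
      constructor
      · intro hx
        by_cases h : x ∈ u '' F
        · obtain ⟨z, hz, rfl⟩ := h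
          exact .inl (.inl ⟨z, ⟨hz, by simpa [gu z hz] using hx⟩, rfl⟩)
        by_cases h' : x ∈ v '' F
        · obtain ⟨z, hz, rfl⟩ := h'
          exact .inl (.inr ⟨z, ⟨hz, by simpa [gv z hz] using hx⟩, rfl⟩)
        exact .inr ⟨by simpa [gid x h h'] using hx, fun hh => hh.elim h h'⟩
      · rintro ((⟨z, ⟨hz, hzT⟩, rfl⟩ | ⟨z, ⟨hz, hzT⟩, rfl⟩) | ⟨hxT, hx⟩)
        · simpa [gu z hz] using hzT
        · simpa [gv z hz] using hzT
        · simpa [gid x (fun h => hx (.inl h)) (fun h => hx (.inr h))] using hxT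
    rw [hpre]
    refine (MeasurableSet.union ?_ ?_).union (hT.diff (.union ?_ ?_))
    · exact (hF.inter (hv hT)).image_of_measurable_injOn hu (huF.mono inter_subset_left)
    · exact (hF.inter (hu hT)).image_of_measurable_injOn hv (hvF.mono inter_subset_left)
    · exact hF.image_of_measurable_injOn hu huF
    · exact hF.image_of_measurable_injOn hv hvF
  · rcases cases_g x with h | ⟨z, hz, ⟨rfl, h⟩ | ⟨rfl, h⟩⟩
    · simp [h]
    · simp [h, gv z hz]
    · simp [h, gu z hz]

/-- **Feldman–Moore theorem, strong form**: every countable Borel equivalence relation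
on a standard Borel space is the union of the graphs of countably many Borel involutions. -/
theorem stmt_0 {X : Type*} [MeasurableSpace X] [StandardBorelSpace X]
    (E : X → X → Prop) (hE : Equivalence E)
    (hBorel : MeasurableSet {p : X × X | E p.1 p.2})
    (hcount : ∀ x : X, {y : X | E x y}.Countable) :
    ∃ g : ℕ → X → X, (∀ n, Measurable (g n)) ∧ (∀ n, g n ∘ g n = id) ∧
      ∀ x y : X, E x y ↔ ∃ n, g n x = y := by
  let Z := {p : X × X | E p.1 p.2}
  have : StandardBorelSpace Z := hBorel.standardBorel
  let u : Z → X := fun z => z.1.1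
  let v : Z → X := fun z => z.1.2
  have hu : Measurable u := measurable_fst.comp measurable_subtype_coe
  have hv : Measurable v := measurable_snd.comp measurable_subtype_coe
  have huv : ∀ z w : Z, u z = u w → v z = v w → z = w := fun z w h h' =>
    Subtype.ext (Prod.ext h h')
  obtain ⟨B, hB, hBu⟩ := hu.isSigmaInjOn_univ fun x =>
    countable_of_injective_of_countable_image (f := v)
      (fun z hz w hw h => huv z w (hz.trans hw.symm) h)
      ((hcount x).mono (by rintro _ ⟨z, rfl, rfl⟩; exact z.2))
  obtain ⟨B', hB', hBv⟩ := hv.isSigmaInjOn_univ fun x =>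
    countable_of_injective_of_countable_image (f := u)
      (fun z hz w hw h => huv z w h (hz.trans hw.symm))
      ((hcount x).mono (by rintro _ ⟨z, rfl, rfl⟩; exact hE.symm z.2))
  let f := embeddingReal X
  have hf : MeasurableEmbedding f := measurableEmbedding_embeddingReal X
  let F (k : ℕ × ℕ × ℚ) : Set Z :=
    B k.1 ∩ B' k.2.1 ∩ (u ⁻¹' (f ⁻¹' Iio (k.2.2 : ℝ)) ∩ v ⁻¹' (f ⁻¹' Ioi (k.2.2 : ℝ)))
  have hF : ∀ k, MeasurableSet (F k) := fun k =>
    ((hB _).1.inter (hB' _).1).inter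
      ((hu (hf.measurable measurableSet_Iio)).inter (hv (hf.measurable measurableSet_Ioi)))
  have hFdisj : ∀ k, Disjoint (u '' F k) (v '' F k) := fun k => by
    rw [disjoint_left]
    rintro _ ⟨z, hz, rfl⟩ ⟨w, hw, hwz⟩
    have h1 : f (u z) < k.2.2 := hz.2.1
    have h2 : (k.2.2 : ℝ) < f (v w) := hw.2.2
    rw [hwz] at h2
    exact h1.not_gt h2
  choose G hGm hGi hGu hG using fun k => exists_measurable_involution hu hv (hF k)
    ((hB _).2.mono fun _ h => h.1.1) ((hB' _).2.mono fun _ h => h.1.2) (hFdisj k)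
  have hGE : ∀ k x, E x (G k x) := fun k x => by
    rcases hG k x with h | ⟨z, -, ⟨hx, h⟩ | ⟨hx, h⟩⟩
    · rw [h]; exact hE.refl x
    · rw [h, hx]; exact z.2
    · rw [h, hx]; exact hE.symm z.2
  have hlt : ∀ x y, E x y → f x < f y → ∃ k, G k x = y := fun x y hxy hlt => by
    let z : Z := ⟨(x, y), hxy⟩
    obtain ⟨m, hm⟩ := mem_iUnion.1 (hBu (mem_univ z))
    obtain ⟨n, hn⟩ := mem_iUnion.1 (hBv (mem_univ z))
    obtain ⟨q, hxq, hqy⟩ := exists_rat_btwn hlt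
    exact ⟨(m, n, q), hGu (m, n, q) z ⟨⟨hm, hn⟩, hxq, hqy⟩⟩
  obtain ⟨e, he⟩ := exists_surjective_nat (Option (ℕ × ℕ × ℚ))
  let g (o : Option (ℕ × ℕ × ℚ)) : X → X := o.elim id G
  have hgm : ∀ o, Measurable (g o) := by
    rintro (_ | k)
    exacts [measurable_id, hGm k]
  have hgi : ∀ o, g o ∘ g o = id := by
    rintro (_ | k)
    exacts [rfl, hGi k]
  have hgE : ∀ o x, E x (g o x) := by
    rintro (_ | k) x
    exacts [hE.refl x, hGE k x]
  refine ⟨fun n => g (e n), fun n => hgm _, fun n => hgi _, fun x y => ⟨fun hxy => ?_, ?_⟩⟩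
  · rw [← he.exists (p := fun o => g o x = y)]
    rcases lt_trichotomy (f x) (f y) with h | h | h
    · obtain ⟨k, hk⟩ := hlt x y hxy h
      exact ⟨some k, hk⟩
    · exact ⟨none, hf.injective h⟩
    · obtain ⟨k, hk⟩ := hlt y x (hE.symm hxy) h
      refine ⟨some k, ?_⟩
      rw [← hk]
      exact congrFun (hGi k) y
  · rintro ⟨n, rfl⟩
    exact hgE _ x
end

section
/- Let M be a set, (f_i : M → M)_{i ∈ ℕ} a family of functions such that for all x, y ∈ M there exists i with f_i x = y, and (U_k)_{k ∈ ℕ} a family of subsets of M separating points. For i, j, k ∈ ℕ define the relation F_{ijk} ⊆ M × M by: F_{ijk}(x, y) iff f_i x = y, f_j y = x, x ∈ U_k, and y ∉ U_k. Then: (a) each F_{ijk} is the graph of a partial injection whose domain and range are disjoint; (b) the function g_{ijk} : M → M defined by g_{ijk}(x) = y when F_{ijk}(x, y) or F_{ijk}(y, x) holds, and g_{ijk}(x) = x when x lies in neither the domain nor the range of F_{ijk}, is a well-defined involution of M; and (c) for all x, y ∈ M there exist i, j, k with g_{ijk}(x) = y. -/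
open Classical in
/-- The map exchanging `x` and `y` whenever `R x y`, and fixing all other points. -/
noncomputable def swapAlong {M : Type*} (R : M → M → Prop) (x : M) : M :=
  if h : ∃ y, R x y ∨ R y x then h.choose else x

theorem swapAlong_eq {M : Type*} {R : M → M → Prop}
    (h₁ : ∀ x y y', R x y → R x y' → y = y') (h₂ : ∀ x x' y, R x y → R x' y → x = x')
    (h₃ : ∀ x, ¬ ((∃ y, R x y) ∧ ∃ z, R z x)) {x y : M} (h : R x y ∨ R y x) :
    swapAlong R x = y := by
  have hex : ∃ y, R x y ∨ R y x := ⟨y, h⟩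
  rw [swapAlong, dif_pos hex]
  rcases hex.choose_spec with hc | hc <;> rcases h with h | h
  · exact h₁ _ _ _ hc h
  · exact absurd ⟨⟨_, hc⟩, ⟨_, h⟩⟩ (h₃ x)
  · exact absurd ⟨⟨_, h⟩, ⟨_, hc⟩⟩ (h₃ x)
  · exact h₂ _ _ _ hc h

theorem swapAlong_of_not_exists {M : Type*} {R : M → M → Prop} {x : M}
    (h : ¬ ∃ y, R x y ∨ R y x) : swapAlong R x = x :=
  dif_neg h

theorem swapAlong_involutive {M : Type*} {R : M → M → Prop}
    (h₁ : ∀ x y y', R x y → R x y' → y = y') (h₂ : ∀ x x' y, R x y → R x' y → x = x')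
    (h₃ : ∀ x, ¬ ((∃ y, R x y) ∧ ∃ z, R z x)) : Function.Involutive (swapAlong R) := by
  intro x
  by_cases hex : ∃ y, R x y ∨ R y x
  · obtain ⟨y, hy⟩ := hex
    rw [swapAlong_eq h₁ h₂ h₃ hy, swapAlong_eq h₁ h₂ h₃ hy.symm]
  · rw [swapAlong_of_not_exists hex, swapAlong_of_not_exists hex]

/-- The explicit construction underlying the Feldman–Moore theorem: from a covering
family of functions (Lusin–Novikov functions) and a countable separating family,
one defines a covering family of involutions. -/
theorem stmt_1 {M : Type*} (f : ℕ → M → M) (U : ℕ → Set M)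
    (hf : ∀ x y : M, ∃ i, f i x = y)
    (hU : ∀ x y : M, x ≠ y → ∃ k, Xor' (x ∈ U k) (y ∈ U k))
    (F : ℕ → ℕ → ℕ → M → M → Prop)
    (hF : ∀ i j k (x y : M),
      F i j k x y ↔ (f i x = y ∧ f j y = x ∧ x ∈ U k ∧ y ∉ U k)) :
    -- (a) each `F i j k` is the graph of a partial injection with disjoint domain and range
    (∀ i j k, (∀ x y y' : M, F i j k x y → F i j k x y' → y = y') ∧
      (∀ x x' y : M, F i j k x y → F i j k x' y → x = x') ∧
      (∀ x : M, ¬ ((∃ y, F i j k x y) ∧ (∃ z, F i j k z x)))) ∧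
    -- (b) the extensions `g i j k` are well-defined involutions, and (c) they cover `M × M`
    (∃ g : ℕ → ℕ → ℕ → M → M,
      (∀ i j k, Function.Involutive (g i j k)) ∧
      (∀ i j k (x y : M), F i j k x y → g i j k x = y ∧ g i j k y = x) ∧
      (∀ i j k (x : M), (¬ ∃ y, F i j k x y) → (¬ ∃ z, F i j k z x) → g i j k x = x) ∧
      (∀ x y : M, ∃ i j k, g i j k x = y)) := by
  have h₁ : ∀ i j k, ∀ x y y' : M, F i j k x y → F i j k x y' → y = y' := by
    intro i j k x y y' h h'
    exact ((hF i j k x y).1 h).1.symm.trans ((hF i j k x y').1 h').1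
  have h₂ : ∀ i j k, ∀ x x' y : M, F i j k x y → F i j k x' y → x = x' := by
    intro i j k x x' y h h'
    exact ((hF i j k x y).1 h).2.1.symm.trans ((hF i j k x' y).1 h').2.1
  have h₃ : ∀ i j k, ∀ x : M, ¬ ((∃ y, F i j k x y) ∧ ∃ z, F i j k z x) := by
    rintro i j k x ⟨⟨y, hy⟩, z, hz⟩
    exact ((hF i j k z x).1 hz).2.2.2 ((hF i j k x y).1 hy).2.2.1
  refine ⟨fun i j k => ⟨h₁ i j k, h₂ i j k, h₃ i j k⟩, fun i j k => swapAlong (F i j k),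
    fun i j k => swapAlong_involutive (h₁ i j k) (h₂ i j k) (h₃ i j k), ?_, ?_, ?_⟩
  · intro i j k x y h
    exact ⟨swapAlong_eq (h₁ i j k) (h₂ i j k) (h₃ i j k) (.inl h),
      swapAlong_eq (h₁ i j k) (h₂ i j k) (h₃ i j k) (.inr h)⟩
  · rintro i j k x hd hr
    exact swapAlong_of_not_exists fun ⟨y, hy⟩ => hy.elim (fun h => hd ⟨y, h⟩) fun h => hr ⟨y, h⟩
  · intro x y
    obtain ⟨i, hi⟩ := hf x y
    obtain ⟨j, hj⟩ := hf y x
    by_cases hxy : x = y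
    · subst hxy
      refine ⟨i, i, 0, swapAlong_of_not_exists ?_⟩
      rintro ⟨z, hz | hz⟩
      · obtain ⟨hz₁, -, hx, hz₂⟩ := (hF _ _ _ _ _).1 hz
        exact hz₂ (hz₁ ▸ hi.symm ▸ hx)
      · obtain ⟨-, hz₁, hz₂, hx⟩ := (hF _ _ _ _ _).1 hz
        exact hx (hi.symm.trans hz₁ ▸ hz₂)
    · obtain ⟨k, ⟨hx, hy⟩ | ⟨hy, hx⟩⟩ := hU x y hxy
      · exact ⟨i, j, k, swapAlong_eq (h₁ i j k) (h₂ i j k) (h₃ i j k)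
          (.inl ((hF _ _ _ _ _).2 ⟨hi, hj, hx, hy⟩))⟩
      · exact ⟨j, i, k, swapAlong_eq (h₁ j i k) (h₂ j i k) (h₃ j i k)
          (.inr ((hF _ _ _ _ _).2 ⟨hj, hi, hy, hx⟩))⟩
end

section
/- Let X be a standard Borel space and E a countable Borel equivalence relation on X. Then there exists a sequence (f_n : X → X)_{n ∈ ℕ} of Borel functions such that for all x, y ∈ X: E x y if and only if there exists n with f_n x = y. (Lusin–Novikov uniformization applied to a CBER: E is the union of the graphs of countably many Borel functions.) -/
open Set Filter Topology MeasureTheory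

/-- A set is a countable union of measurable sets on each of which `f` is injective. -/
def IsCountableUnionInjOn {Z X : Type*} [MeasurableSpace Z] (f : Z → X) (M : Set Z) : Prop :=
  ∃ B : ℕ → Set Z, (∀ n, MeasurableSet (B n) ∧ InjOn f (B n)) ∧ M = ⋃ n, B n

namespace IsCountableUnionInjOn

variable {Z X : Type*} [MeasurableSpace Z] {f : Z → X}

theorem measurableSet {M : Set Z} (hM : IsCountableUnionInjOn f M) : MeasurableSet M := by
  obtain ⟨B, hB, rfl⟩ := hM
  exact MeasurableSet.iUnion fun n => (hB n).1

theorem of_injOn {M : Set Z} (hM : MeasurableSet M) (hf : InjOn f M) :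
    IsCountableUnionInjOn f M :=
  ⟨fun _ => M, fun _ => ⟨hM, hf⟩, (iUnion_const M).symm⟩

theorem iUnion {ι : Type*} [Countable ι] {M : ι → Set Z}
    (hM : ∀ i, IsCountableUnionInjOn f (M i)) : IsCountableUnionInjOn f (⋃ i, M i) := by
  choose B hB hMB using hM
  rcases isEmpty_or_nonempty ι with hι | hι
  · simpa using of_injOn (f := f) MeasurableSet.empty (injOn_empty f)
  obtain ⟨e, he⟩ := exists_surjective_nat (ι × ℕ)
  refine ⟨fun n => B (e n).1 (e n).2, fun n => hB _ _, ?_⟩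
  rw [he.iUnion_comp (fun p : ι × ℕ => B p.1 p.2), iUnion_prod']
  exact iUnion_congr hMB

theorem union {M N : Set Z} (hM : IsCountableUnionInjOn f M) (hN : IsCountableUnionInjOn f N) :
    IsCountableUnionInjOn f (M ∪ N) := by
  rw [union_eq_iUnion]
  exact iUnion fun b => by cases b <;> assumption

end IsCountableUnionInjOn

/-- If `f` is injective on an analytic set, it is injective on some Borel superset. -/
theorem MeasureTheory.AnalyticSet.exists_measurableSet_superset_injOn {Z X : Type*}
    [TopologicalSpace Z] [PolishSpace Z] [MeasurableSpace Z] [BorelSpace Z]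
    [TopologicalSpace X] [T2Space X] [MeasurableSpace X] [BorelSpace X]
    {f : Z → X} (hf : Continuous f) {T : Set Z} (hT : AnalyticSet T) (hinj : InjOn f T) :
    ∃ B, T ⊆ B ∧ MeasurableSet B ∧ InjOn f B := by
  obtain ⟨S, hS, hsep⟩ := exists_seq_separating Z MeasurableSet.univ (univ : Set Z)
  have hinter : ∀ s : Set Z, MeasurableSet s → AnalyticSet (T ∩ s) := fun s hs => by
    rw [inter_eq_iInter]
    exact AnalyticSet.iInter fun b => by
      cases b
      · exact hs.analyticSet
      · exact hT
  have hC : ∀ n, MeasurablySeparable (f '' (T ∩ S n)) (f '' (T ∩ (S n)ᶜ)) := fun n => by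
    refine ((hinter _ (hS n)).image_of_continuous hf).measurablySeparable
      ((hinter _ (hS n).compl).image_of_continuous hf) ?_
    rw [disjoint_left]
    rintro _ ⟨z, hz, rfl⟩ ⟨w, hw, h⟩
    obtain rfl := hinj hw.1 hz.1 h
    exact hw.2 hz.2
  choose C hCl hCr hCm using hC
  refine ⟨⋂ n, {z | z ∈ S n ↔ f z ∈ C n}, ?_, ?_, ?_⟩
  · intro z hz
    refine mem_iInter.2 fun n => ⟨fun h => hCl n ⟨z, ⟨hz, h⟩, rfl⟩, fun h => ?_⟩
    by_contra hzn
    exact disjoint_left.1 (hCr n) ⟨z, ⟨hz, hzn⟩, rfl⟩ h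
  · refine MeasurableSet.iInter fun n => ?_
    exact MeasurableSet.iff (hS n) (hf.measurable (hCm n))
  · intro z hz w hw h
    refine hsep z (mem_univ z) w (mem_univ w) fun n => ?_
    have h1 := mem_iInter.1 hz n
    have h2 := mem_iInter.1 hw n
    simp only [mem_ofPred_eq] at h1 h2
    rw [h1, h2, h]

/-- A family of sets is `f`-linked if, after removing any set that is a countable union of
measurable sets on which `f` is injective, some fibre of `f` still meets all of its members. -/
def FiberLinked {Z X κ : Type*} [MeasurableSpace Z] (f : Z → X) (U : κ → Set Z) : Prop :=
  ∀ M, IsCountableUnionInjOn f M → ∃ x, ∀ k, ∃ z ∈ U k, z ∉ M ∧ f z = x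

section Splitting

variable {Z X : Type*} [MetricSpace Z] [CompleteSpace Z] [SecondCountableTopology Z]
  [MeasurableSpace Z] [BorelSpace Z] [TopologicalSpace X] [T2Space X] [MeasurableSpace X]
  [BorelSpace X] {f : Z → X}

/-- There are countably many closed sets of small diameter separating any two points. -/
theorem exists_countable_closed_separating (Z : Type*) [MetricSpace Z]
    [SecondCountableTopology Z] {ε : ℝ} (hε : 0 < ε) :
    ∃ D : Set (Set Z), D.Countable ∧ (∀ V ∈ D, IsClosed V ∧ ∀ p ∈ V, ∀ q ∈ V, dist p q ≤ ε) ∧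
      ∀ z w, z ≠ w → ∃ V ∈ D, ∃ W ∈ D, z ∈ V ∧ w ∈ W ∧ Disjoint V W := by
  obtain ⟨s, hsc, hsd⟩ := TopologicalSpace.exists_countable_dense Z
  let D₀ : Set (Set Z) :=
    image2 (fun c (n : ℕ) => Metric.closedBall c (1 / ((n : ℝ) + 1))) s univ
  refine ⟨{V ∈ D₀ | IsClosed V ∧ ∀ p ∈ V, ∀ q ∈ V, dist p q ≤ ε},
    (hsc.image2 (to_countable univ) _).mono fun V h => h.1, fun V h => h.2, ?_⟩
  intro z w hzw
  have hpos : 0 < min ε (dist z w / 4) := lt_min hε (by have := dist_pos.2 hzw; positivity)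
  obtain ⟨n, hn⟩ := exists_nat_one_div_lt hpos
  obtain ⟨n', hn'⟩ := exists_nat_one_div_lt (half_pos hpos)
  have hr : (0 : ℝ) < 1 / ((n' : ℝ) + 1) := by positivity
  have h1 := min_le_left ε (dist z w / 4)
  have h2 := min_le_right ε (dist z w / 4)
  obtain ⟨c, hc, hzc⟩ := hsd.exists_dist_lt z hr
  obtain ⟨d, hd, hwd⟩ := hsd.exists_dist_lt w hr
  have key : ∀ c ∈ s, Metric.closedBall c (1 / ((n' : ℝ) + 1)) ∈
      {V ∈ D₀ | IsClosed V ∧ ∀ p ∈ V, ∀ q ∈ V, dist p q ≤ ε} := fun c hc => by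
    refine ⟨⟨c, hc, n', mem_univ _, rfl⟩, Metric.isClosed_closedBall, fun p hp q hq => ?_⟩
    rw [Metric.mem_closedBall] at hp hq
    linarith [dist_triangle_right p q c]
  refine ⟨_, key c hc, _, key d hd, hzc.le, hwd.le, disjoint_left.2 fun q hq hq' => ?_⟩
  rw [Metric.mem_closedBall] at hq hq'
  have h3 := dist_triangle z c w
  have h4 := dist_triangle c q w
  have h5 := dist_triangle q d w
  rw [dist_comm c q] at h4
  rw [dist_comm d w] at h5
  linarith

open Function in
/-- Two equal members of a linked family can be shrunk to disjoint closed sets of small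
diameter. -/
theorem FiberLinked.exists_update (hf : Continuous f) {κ : Type*} [Countable κ] [DecidableEq κ]
    {U : κ → Set Z} (hcl : ∀ k, IsClosed (U k)) (hU : FiberLinked f U) {a b : κ} (hab : a ≠ b)
    (hUab : U a = U b) {ε : ℝ} (hε : 0 < ε) :
    ∃ V W : Set Z, IsClosed V ∧ IsClosed W ∧ V ⊆ U a ∧ W ⊆ U a ∧ Disjoint V W ∧
      (∀ p ∈ V, ∀ q ∈ V, dist p q ≤ ε) ∧ (∀ p ∈ W, ∀ q ∈ W, dist p q ≤ ε) ∧
      FiberLinked f (update (update U a V) b W) := by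
  by_contra! hcon
  obtain ⟨D, hDc, hD, hsep⟩ := exists_countable_closed_separating Z hε
  have : Countable D := hDc.to_subtype
  have hM : ∀ P : D × D, ∃ M, IsCountableUnionInjOn f M ∧ (Disjoint (P.1 : Set Z) P.2 →
      ∀ x, ∃ k, ∀ z ∈ update (update U a (U a ∩ P.1)) b (U a ∩ P.2) k, z ∉ M → f z ≠ x) := by
    intro P
    by_cases hP : Disjoint (P.1 : Set Z) P.2
    · have h := hcon (U a ∩ P.1) (U a ∩ P.2) ((hcl a).inter (hD _ P.1.2).1)
        ((hcl a).inter (hD _ P.2.2).1) inter_subset_left inter_subset_left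
        (hP.mono inter_subset_right inter_subset_right)
        (fun p hp q hq => (hD _ P.1.2).2 p hp.2 q hq.2)
        (fun p hp q hq => (hD _ P.2.2).2 p hp.2 q hq.2)
      simp only [FiberLinked] at h
      push Not at h
      obtain ⟨M, hM, h⟩ := h
      exact ⟨M, hM, fun _ => h⟩
    · exact ⟨∅, .of_injOn .empty (injOn_empty f), fun h => absurd h hP⟩
  choose M hMs hM using hM
  have hN := IsCountableUnionInjOn.iUnion hMs
  set N := ⋃ P, M P
  let T : Set Z := ⋂ k, (U a \ N) ∩ f ⁻¹' (f '' (U k \ N))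
  have : Nonempty κ := ⟨a⟩
  have hTan : AnalyticSet T := AnalyticSet.iInter fun k => by
    rw [inter_eq_iInter]
    refine AnalyticSet.iInter fun c => ?_
    cases c
    · exact ((((hcl k).measurableSet.diff hN.measurableSet).analyticSet).image_of_continuous
        hf).preimage hf
    · exact ((hcl a).measurableSet.diff hN.measurableSet).analyticSet
  have hTinj : InjOn f T := by
    intro z hz w hw hzw
    by_contra hne
    obtain ⟨V, hV, W, hW, hzV, hwW, hVW⟩ := hsep z w hne
    obtain ⟨k, hk⟩ := hM (⟨V, hV⟩, ⟨W, hW⟩) hVW (f z)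
    have hnot : ∀ y, y ∉ N → y ∉ M (⟨V, hV⟩, ⟨W, hW⟩) := fun y hy h => hy (mem_iUnion.2 ⟨_, h⟩)
    have hz' := (mem_iInter.1 hz a).1
    have hw' := (mem_iInter.1 hw a).1
    rcases eq_or_ne k b with rfl | hkb
    · exact hk w (by simpa using ⟨hw'.1, hwW⟩) (hnot w hw'.2) hzw.symm
    rcases eq_or_ne k a with rfl | hka
    · exact hk z (by simpa [hkb] using ⟨hz'.1, hzV⟩) (hnot z hz'.2) rfl
    · obtain ⟨y, hy, hyz⟩ := (mem_iInter.1 hz k).2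
      exact hk y (by simpa [hkb, hka] using hy.1) (hnot y hy.2) hyz
  obtain ⟨B, hTB, hB, hBinj⟩ := hTan.exists_measurableSet_superset_injOn hf hTinj
  obtain ⟨x, hx⟩ := hU _ (hN.union (.of_injOn hB hBinj))
  obtain ⟨z, hza, hzN, rfl⟩ := hx a
  refine hzN (Or.inr (hTB (mem_iInter.2 fun k => ⟨⟨hza, fun h => hzN (Or.inl h)⟩, ?_⟩)))
  obtain ⟨y, hy, hyN, hyz⟩ := hx k
  exact ⟨y, ⟨hy, fun h => hyN (Or.inl h)⟩, hyz⟩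

/-- Every member of a finite linked family of closed sets can be split into two disjoint closed
subsets of small diameter, keeping the family linked. -/
theorem FiberLinked.exists_split (hf : Continuous f) {ι : Type*} [Finite ι]
    {U : ι → Set Z} (hcl : ∀ i, IsClosed (U i)) (hU : FiberLinked f U) {ε : ℝ} (hε : 0 < ε) :
    ∃ V : ι × Bool → Set Z, (∀ p, IsClosed (V p)) ∧ (∀ p, V p ⊆ U p.1) ∧
      (∀ i, Disjoint (V (i, true)) (V (i, false))) ∧
      (∀ k, ∀ p ∈ V k, ∀ q ∈ V k, dist p q ≤ ε) ∧ FiberLinked f V := by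
  classical
  have := Fintype.ofFinite ι
  suffices h : ∀ S : Finset ι, ∃ V : ι × Bool → Set Z, (∀ p, IsClosed (V p)) ∧
      (∀ p, V p ⊆ U p.1) ∧ (∀ i ∉ S, ∀ b, V (i, b) = U i) ∧
      (∀ i ∈ S, Disjoint (V (i, true)) (V (i, false))) ∧
      (∀ i ∈ S, ∀ b, ∀ p ∈ V (i, b), ∀ q ∈ V (i, b), dist p q ≤ ε) ∧ FiberLinked f V by
    obtain ⟨V, h1, h2, -, h4, h5, h6⟩ := h Finset.univ
    exact ⟨V, h1, h2, fun i => h4 i (Finset.mem_univ i),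
      fun k => h5 k.1 (Finset.mem_univ _) k.2, h6⟩
  intro S
  induction S using Finset.induction_on with
  | empty =>
    refine ⟨fun p => U p.1, fun p => hcl _, fun p => Subset.rfl, fun _ _ _ => rfl, by simp,
      by simp, fun M hM => ?_⟩
    obtain ⟨x, hx⟩ := hU M hM
    exact ⟨x, fun k => hx k.1⟩
  | insert a S ha ih =>
    obtain ⟨V, h1, h2, h3, h4, h5, h6⟩ := ih
    obtain ⟨A, B, hA, hB, hAU, hBU, hAB, hAd, hBd, hl⟩ := h6.exists_update hf h1
      (a := (a, true)) (b := (a, false)) (by simp) (by rw [h3 a ha, h3 a ha]) hε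
    rw [h3 a ha] at hAU hBU
    set V' := Function.update (Function.update V (a, true) A) (a, false) B with hV'
    have hfalse : V' (a, false) = B := by simp [hV']
    have htrue : V' (a, true) = A := by simp [hV']
    have hne : ∀ i ≠ a, ∀ b, V' (i, b) = V (i, b) := fun i hi b => by simp [hV', hi]
    refine ⟨V', ?_, ?_, ?_, ?_, ?_, hl⟩
    · rintro ⟨i, b⟩
      rcases eq_or_ne i a with rfl | hi
      · cases b <;> simpa [hfalse, htrue]
      · rw [hne i hi]; exact h1 _
    · rintro ⟨i, b⟩
      rcases eq_or_ne i a with rfl | hi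
      · cases b <;> simpa [hfalse, htrue]
      · rw [hne i hi]; exact h2 _
    · intro i hi b
      rw [Finset.mem_insert, not_or] at hi
      rw [hne i hi.1, h3 i hi.2]
    · intro i hi
      rcases eq_or_ne i a with rfl | hia
      · rwa [hfalse, htrue]
      · rw [hne i hia, hne i hia]; exact h4 i (Finset.mem_of_mem_insert_of_ne hi hia)
    · intro i hi b
      rcases eq_or_ne i a with rfl | hia
      · cases b
        · rwa [hfalse]
        · rwa [htrue]
      · rw [hne i hia]; exact h5 i (Finset.mem_of_mem_insert_of_ne hi hia) b

/-- A Cantor scheme of linked families exists unless the whole space is a countable union of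
measurable sets on which `f` is injective. -/
theorem exists_fiberLinked_scheme (hf : Continuous f) (h : ¬ IsCountableUnionInjOn f univ) :
    ∃ U : ∀ n, (Fin n → Bool) → Set Z, (∀ n, FiberLinked f (U n)) ∧
      (∀ n s, U (n + 1) s ⊆ U n (Fin.init s)) ∧
      (∀ n s, ∀ p ∈ U (n + 1) s, ∀ q ∈ U (n + 1) s, dist p q ≤ (1 / 2 : ℝ) ^ n) ∧
      (∀ n s, IsClosed (U n s)) ∧
      ∀ n s t, Fin.init s = Fin.init t → s (Fin.last n) ≠ t (Fin.last n) →
        Disjoint (U (n + 1) s) (U (n + 1) t) := by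
  let State (n : ℕ) : Type _ :=
    {U : (Fin n → Bool) → Set Z // (∀ s, IsClosed (U s)) ∧ FiberLinked f U}
  have hstep : ∀ n (U : State n), ∃ V : State (n + 1), (∀ s, V.1 s ⊆ U.1 (Fin.init s)) ∧
      (∀ s, ∀ p ∈ V.1 s, ∀ q ∈ V.1 s, dist p q ≤ (1 / 2 : ℝ) ^ n) ∧
      ∀ s t, Fin.init s = Fin.init t → s (Fin.last n) ≠ t (Fin.last n) →
        Disjoint (V.1 s) (V.1 t) := by
    rintro n ⟨U, hcl, hU⟩
    obtain ⟨V, h1, h2, h3, h4, h5⟩ := hU.exists_split hf hcl (ε := (1 / 2 : ℝ) ^ n) (by positivity)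
    refine ⟨⟨fun s => V (Fin.init s, s (Fin.last n)), fun s => h1 _, fun M hM => ?_⟩,
      fun s => h2 _, fun s => h4 _, fun s t hst hne => ?_⟩
    · obtain ⟨x, hx⟩ := h5 M hM
      exact ⟨x, fun s => hx _⟩
    · simp only [hst]
      cases hs : s (Fin.last n) <;> cases ht : t (Fin.last n)
      · simp [hs, ht] at hne
      · exact (h3 _).symm
      · exact h3 _
      · simp [hs, ht] at hne
  choose next hnext using hstep
  have hbase : FiberLinked f fun _ : Fin 0 → Bool => (univ : Set Z) := fun M hM => by
    have hne : M ≠ univ := fun h' => h (h' ▸ hM)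
    obtain ⟨z, hz⟩ := (ne_univ_iff_exists_notMem M).1 hne
    exact ⟨f z, fun _ => ⟨z, mem_univ z, hz, rfl⟩⟩
  let U : ∀ n, State n := fun n => Nat.rec ⟨_, fun _ => isClosed_univ, hbase⟩ next n
  exact ⟨fun n => (U n).1, fun n => (U n).2.2, fun n => (hnext n (U n)).1,
    fun n => (hnext n (U n)).2.1, fun n => (U n).2.1, fun n => (hnext n (U n)).2.2⟩

/-- A continuous countable-to-one function on a complete separable metric space is injective on each
piece of some countable Borel cover. -/
theorem isCountableUnionInjOn_univ_of_continuous (hf : Continuous f)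
    (hc : ∀ x, (f ⁻¹' {x}).Countable) : IsCountableUnionInjOn f univ := by
  by_contra hcon
  obtain ⟨U, hlink, hsub, hdist, hcl, hdisj⟩ := exists_fiberLinked_scheme hf hcon
  have hpts : ∀ n, ∃ x, ∀ s, ∃ z ∈ U n s, f z = x := fun n => by
    obtain ⟨x, hx⟩ := hlink n ∅ (.of_injOn .empty (injOn_empty f))
    exact ⟨x, fun s => (hx s).imp fun z hz => ⟨hz.1, hz.2.2⟩⟩
  choose x p hpU hpx using hpts
  let r (α : ℕ → Bool) (n : ℕ) : Fin n → Bool := fun i => α i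
  have hanti : ∀ α, Antitone fun n => U n (r α n) := fun α =>
    antitone_nat_of_succ_le fun n => hsub n (r α (n + 1))
  have hcauchy : ∀ α, CauchySeq fun n => p (n + 1) (r α (n + 1)) := fun α =>
    cauchySeq_of_le_geometric (1 / 2) 1 (by norm_num) fun n => by
      rw [one_mul]
      exact hdist n (r α (n + 1)) _ (hpU _ _) _
        (hanti α (Nat.le_succ (n + 1)) (hpU (n + 2) (r α (n + 2))))
  choose z hz using fun α => cauchySeq_tendsto_of_complete (hcauchy α)
  have hzU : ∀ α n, z α ∈ U n (r α n) := fun α n =>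
    (hcl n _).mem_of_tendsto (hz α) <| (eventually_ge_atTop n).mono fun m hm =>
      hanti α (hm.trans (Nat.le_succ m)) (hpU _ _)
  have hfz : ∀ α, Tendsto (fun n => x (n + 1)) atTop (𝓝 (f (z α))) := fun α =>
    ((hf.tendsto _).comp (hz α)).congr fun n => hpx _ _
  have hconst : ∀ α, f (z α) = f (z fun _ => true) := fun α =>
    tendsto_nhds_unique (hfz α) (hfz _)
  have hinj : Function.Injective z := by
    intro α β hαβ
    suffices h : ∀ n, r α n = r β n from
      funext fun n => congrFun (h (n + 1)) (Fin.last n)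
    intro n
    induction n with
    | zero => exact Subsingleton.elim _ _
    | succ n ih =>
      by_contra hne
      have hlast : r α (n + 1) (Fin.last n) ≠ r β (n + 1) (Fin.last n) := fun hl => by
        refine hne ?_
        rw [← Fin.snoc_init_self (r α (n + 1)), ← Fin.snoc_init_self (r β (n + 1)), hl]
        exact congrArg (fun s => Fin.snoc (α := fun _ => Bool) s _) ih
      exact disjoint_left.1 (hdisj n (r α (n + 1)) (r β (n + 1)) ih hlast) (hzU α (n + 1))
        (hαβ ▸ hzU β (n + 1))
  have hrange : (range z).Countable :=
    (hc (f (z fun _ => true))).mono (range_subset_iff.2 hconst)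
  have : Countable (ℕ → Bool) := by
    have := hrange.to_subtype
    exact (rangeFactorization_injective.2 hinj).countable
  refine (Cardinal.mk_le_aleph0 (α := ℕ → Bool)).not_gt ?_
  rw [Cardinal.mk_pi, Cardinal.prod_const]
  simpa only [Cardinal.mk_bool, Cardinal.mk_nat, Cardinal.lift_aleph0, Cardinal.lift_ofNat] using
    Cardinal.cantor Cardinal.aleph0

end Splitting

/-- A countable-to-one Borel function between standard Borel spaces is injective on each piece of
some countable Borel cover. -/
theorem isCountableUnionInjOn_univ {Z X : Type*} [MeasurableSpace Z] [StandardBorelSpace Z]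
    [MeasurableSpace X] [StandardBorelSpace X] {f : Z → X} (hf : Measurable f)
    (hc : ∀ x, (f ⁻¹' {x}).Countable) : IsCountableUnionInjOn f univ := by
  obtain ⟨tX, hXborel, hXpolish⟩ := StandardBorelSpace.polish (α := X)
  obtain ⟨t, hborel, hpolish⟩ := StandardBorelSpace.polish (α := Z)
  obtain ⟨t', ht', hf', hpolish'⟩ := hf.exists_continuous
  have hborel' : @BorelSpace Z t' _ :=
    @BorelSpace.mk Z t' _
      (hborel.measurable_eq.trans (borel_eq_borel_of_le hpolish' hpolish ht').symm)
  clear hborel hpolish ht' t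
  let := TopologicalSpace.upgradeIsCompletelyMetrizable Z
  exact isCountableUnionInjOn_univ_of_continuous hf' hc

/-- **Lusin–Novikov uniformization applied to a CBER**: every countable Borel equivalence
relation is the union of the graphs of countably many Borel functions. -/
theorem stmt_2 {X : Type*} [MeasurableSpace X] [StandardBorelSpace X]
    (E : X → X → Prop) (hE : Equivalence E)
    (hBorel : MeasurableSet {p : X × X | E p.1 p.2})
    (hcount : ∀ x : X, {y : X | E x y}.Countable) :
    ∃ f : ℕ → X → X, (∀ n, Measurable (f n)) ∧
      ∀ x y : X, E x y ↔ ∃ n, f n x = y := by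
  have : StandardBorelSpace {p : X × X | E p.1 p.2} := hBorel.standardBorel
  let π : {p : X × X | E p.1 p.2} → X := fun p => p.1.1
  let ρ : {p : X × X | E p.1 p.2} → X := fun p => p.1.2
  have hπ : Measurable π := measurable_fst.comp measurable_subtype_coe
  have hρ : Measurable ρ := measurable_snd.comp measurable_subtype_coe
  have hfib : ∀ x, (π ⁻¹' {x}).Countable := fun x => by
    refine MapsTo.countable_of_injOn (f := ρ) (t := {y | E x y}) ?_ ?_ (hcount x)
    · rintro ⟨⟨a, b⟩, hab⟩ rfl
      exact hab
    · rintro ⟨⟨a, b⟩, hab⟩ rfl ⟨⟨c, d⟩, hcd⟩ hc hbd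
      exact Subtype.ext (Prod.ext (Eq.symm hc) hbd)
  obtain ⟨B, hB, hcover⟩ := isCountableUnionInjOn_univ hπ hfib
  have himage : ∀ n S, MeasurableSet S → MeasurableSet (π '' (B n ∩ ρ ⁻¹' S)) := fun n S hS =>
    ((hB n).1.inter (hρ hS)).image_of_measurable_injOn hπ ((hB n).2.mono inter_subset_left)
  have hg : ∀ n x, ∃ y, (∀ p ∈ B n, π p = x → ρ p = y) ∧ (x ∉ π '' B n → y = x) := fun n x => by
    by_cases hx : x ∈ π '' B n
    · obtain ⟨p, hp, rfl⟩ := hx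
      exact ⟨ρ p, fun q hq hqp => congrArg ρ ((hB n).2 hq hp hqp),
        fun h => absurd (mem_image_of_mem π hp) h⟩
    · exact ⟨x, fun p hp hpx => absurd ⟨p, hp, hpx⟩ hx, fun _ => rfl⟩
  choose g hg hg' using hg
  refine ⟨g, fun n S hS => ?_, fun x y => ⟨fun hxy => ?_, ?_⟩⟩
  · have hpre : g n ⁻¹' S = π '' (B n ∩ ρ ⁻¹' S) ∪ (S \ π '' (B n ∩ ρ ⁻¹' univ)) := by
      ext x
      rw [preimage_univ, inter_univ]
      by_cases hx : x ∈ π '' B n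
      · obtain ⟨p, hp, rfl⟩ := hx
        have hgp := hg n (π p) p hp rfl
        constructor
        · intro h
          exact Or.inl ⟨p, ⟨hp, by rwa [mem_preimage, hgp]⟩, rfl⟩
        · rintro (⟨q, ⟨hq, hqS⟩, hqp⟩ | h)
          · rw [mem_preimage, ← hg n (π p) q hq hqp]
            exact hqS
          · exact absurd (mem_image_of_mem π hp) h.2
      · rw [mem_preimage, hg' n x hx]
        exact ⟨fun h => Or.inr ⟨h, hx⟩,
          fun h => h.elim (fun h => absurd (image_mono inter_subset_left h) hx) And.left⟩
    rw [hpre]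
    exact (himage n S hS).union (hS.diff (himage n univ MeasurableSet.univ))
  · obtain ⟨n, hn⟩ := mem_iUnion.1 (hcover ▸ mem_univ (⟨(x, y), hxy⟩ : {p : X × X | E p.1 p.2}))
    exact ⟨n, (hg n x _ hn rfl).symm⟩
  · rintro ⟨n, rfl⟩
    by_cases hx : x ∈ π '' B n
    · obtain ⟨p, hp, rfl⟩ := hx
      rw [← hg n (π p) p hp rfl]
      exact p.2
    · rw [hg' n x hx]
      exact hE.refl x
end

section
/- Let X be a standard Borel space and E a countable Borel equivalence relation on X. Then there exists a sequence (g_n)_{n ∈ ℕ} of Borel bijections of X (bijections g_n : X → X with g_n and g_n⁻¹ Borel) such that for all x, y ∈ X: E x y if and only if there exists n with g_n x = y. Moreover, this can be proved using only the Lusin–Novikov uniformization theorem (i.e., starting from any sequence of Borel functions whose graphs cover E, without using a countable separating family of Borel sets). -/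
open Set Function Filter Topology MeasureTheory

section LusinNovikov

variable {P X : Type*}

/-- The set `B` is a countable union of measurable sets on each of which `p` is injective. -/
def CountablyInjOn [MeasurableSpace P] (p : P → X) (B : Set P) : Prop :=
  ∃ S : ℕ → Set P, (∀ n, MeasurableSet (S n) ∧ InjOn p (S n)) ∧ B = ⋃ n, S n

namespace CountablyInjOn

variable [MeasurableSpace P] {p : P → X}

lemma measurableSet {B : Set P} (h : CountablyInjOn p B) : MeasurableSet B := by
  obtain ⟨S, hS, rfl⟩ := h
  exact .iUnion fun n => (hS n).1

lemma of_injOn {B : Set P} (hB : MeasurableSet B) (h : InjOn p B) : CountablyInjOn p B :=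
  ⟨fun _ => B, fun _ => ⟨hB, h⟩, (iUnion_const B).symm⟩

lemma iUnion {ι : Type*} [Countable ι] [Nonempty ι] {B : ι → Set P}
    (h : ∀ i, CountablyInjOn p (B i)) : CountablyInjOn p (⋃ i, B i) := by
  choose S hS hB using h
  obtain ⟨e, he⟩ := exists_surjective_nat (ι × ℕ)
  refine ⟨fun n => S (e n).1 (e n).2, fun n => hS _ _, ?_⟩
  rw [he.iUnion_comp (fun a : ι × ℕ => S a.1 a.2), iUnion_prod']
  exact iUnion_congr hB

lemma union {B B' : Set P} (h : CountablyInjOn p B) (h' : CountablyInjOn p B') :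
    CountablyInjOn p (B ∪ B') := by
  rw [union_eq_iUnion]
  exact .iUnion (Bool.forall_bool.2 ⟨h', h⟩)

end CountablyInjOn

/-- A set of sequences is small up to `n` if some set in the `σ`-ideal of `CountablyInjOn` sets
contains one of the first `n + 1` terms of each of its members. -/
def IsSmallUpTo [MeasurableSpace P] (p : P → X) (n : ℕ) (C : Set (ℕ → P)) : Prop :=
  ∃ B, CountablyInjOn p B ∧ ∀ φ ∈ C, ∃ k ≤ n, φ k ∈ B

lemma IsSmallUpTo.iUnion [MeasurableSpace P] {p : P → X} {ι : Type*} [Countable ι]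
    [Nonempty ι] {n : ℕ} {C : ι → Set (ℕ → P)}
    (h : ∀ i, IsSmallUpTo p n (C i)) : IsSmallUpTo p n (⋃ i, C i) := by
  choose B hB hC using h
  refine ⟨⋃ i, B i, .iUnion hB, fun φ hφ => ?_⟩
  obtain ⟨i, hi⟩ := mem_iUnion.1 hφ
  obtain ⟨k, hk, hkB⟩ := hC i φ hi
  exact ⟨k, hk, mem_iUnion.2 ⟨i, hkB⟩⟩

/-- The sequences obtained from a sequence in `C` by replacing its term of index `n + 1` by the
`i`-th term of another sequence of `C`, which is distinct from the `i`-th term of the first one but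
lies in the same fibre of `p`. -/
def splitting (p : P → X) (n i : ℕ) (C : Set (ℕ → P)) : Set (ℕ → P) :=
  (fun q : (ℕ → P) × (ℕ → P) => update q.1 (n + 1) (q.2 i)) ''
    {q | (q.1 ∈ C ∧ q.2 ∈ C) ∧ p (q.1 i) = p (q.2 i) ∧ q.1 i ≠ q.2 i}

lemma exists_eq_of_mem_splitting {p : P → X} {C : Set (ℕ → P)} {n i : ℕ} (hi : i ≤ n) {ψ : ℕ → P}
    (hψ : ψ ∈ splitting p n i C) :
    ∃ φ ∈ C, ∃ φ' ∈ C, (∀ k ≤ n, ψ k = φ k) ∧ ψ (n + 1) = φ' i ∧ p (ψ (n + 1)) = p (ψ i) ∧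
      ψ i ≠ ψ (n + 1) := by
  obtain ⟨⟨φ, φ'⟩, ⟨⟨hφ, hφ'⟩, hp, hne⟩, rfl⟩ := hψ
  have h : ∀ k ≤ n, update φ (n + 1) (φ' i) k = φ k := fun k hk =>
    update_of_ne (by omega) _ _
  refine ⟨φ, hφ, φ', hφ', h, ?_, ?_, ?_⟩
  · simp
  · simpa [h i hi] using hp.symm
  · simpa [h i hi] using hne

lemma MeasureTheory.AnalyticSet.inter [TopologicalSpace P] [T2Space P] {s t : Set P}
    (hs : AnalyticSet s) (ht : AnalyticSet t) : AnalyticSet (s ∩ t) := by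
  rw [inter_eq_iInter]
  exact .iInter (Bool.forall_bool.2 ⟨ht, hs⟩)

variable [TopologicalSpace P] [PolishSpace P] [MeasurableSpace P] [BorelSpace P]
  [TopologicalSpace X] [T2Space X] {p : P → X}

/-- The set of points which have the same image under `p` as some other point of an analytic set
is analytic. -/
lemma MeasureTheory.AnalyticSet.collisions (hp : Continuous p) {A : Set P} (hA : AnalyticSet A) :
    AnalyticSet {b | ∃ a ∈ A, p a = p b ∧ a ≠ b} := by
  have hG : MeasurableSet {q : P × P | p q.1 = p q.2 ∧ q.1 ≠ q.2} :=
    (isClosed_eq (hp.comp continuous_fst) (hp.comp continuous_snd)).measurableSet.inter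
      (isClosed_eq continuous_fst continuous_snd).measurableSet.compl
  convert! ((hA.preimage continuous_fst).inter hG.analyticSet).image_of_continuous continuous_snd
  ext b
  simp

/-- An analytic set on which `p` is injective is contained in a measurable such set. -/
lemma MeasureTheory.AnalyticSet.exists_measurableSet_injOn (hp : Continuous p) {A : Set P}
    (hA : AnalyticSet A) (hinj : InjOn p A) : ∃ B, A ⊆ B ∧ MeasurableSet B ∧ InjOn p B := by
  obtain ⟨B₀, hAB₀, hB₀, hB₀m⟩ := hA.measurablySeparable (hA.collisions hp) <| by
    rw [disjoint_left]
    rintro b hb ⟨a, ha, hab, hne⟩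
    exact hne (hinj ha hb hab)
  obtain ⟨B₁, hAB₁, hB₁, hB₁m⟩ := hA.measurablySeparable (hB₀m.analyticSet.collisions hp) <| by
    rw [disjoint_left]
    rintro b hb ⟨a, ha, hab, hne⟩
    exact disjoint_left.1 hB₀ ⟨b, hb, hab.symm, hne.symm⟩ ha
  refine ⟨B₀ ∩ B₁, subset_inter hAB₀ hAB₁, hB₀m.inter hB₁m, fun a ha b hb hab => ?_⟩
  by_contra hne
  exact disjoint_left.1 hB₁ ⟨a, ha.1, hab, hne⟩ hb.2

lemma MeasureTheory.AnalyticSet.splitting (hp : Continuous p) {C : Set (ℕ → P)}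
    (hC : AnalyticSet C) (n i : ℕ) : AnalyticSet (splitting p n i C) := by
  have hG : MeasurableSet {q : (ℕ → P) × (ℕ → P) | p (q.1 i) = p (q.2 i) ∧ q.1 i ≠ q.2 i} :=
    (isClosed_eq (by fun_prop) (by fun_prop)).measurableSet.inter
      (isClosed_eq (by fun_prop) (by fun_prop)).measurableSet.compl
  exact (((hC.preimage continuous_fst).inter (hC.preimage continuous_snd)).inter
    hG.analyticSet).image_of_continuous
    (continuous_fst.update _ ((continuous_apply i).comp continuous_snd))

lemma not_isSmallUpTo_splitting (hp : Continuous p) {C : Set (ℕ → P)} (hC : AnalyticSet C)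
    {n i : ℕ} (hi : i ≤ n) (hlarge : ¬ IsSmallUpTo p n C) :
    ¬ IsSmallUpTo p (n + 1) (splitting p n i C) := by
  rintro ⟨B, hB, hBC⟩
  have hU : MeasurableSet {φ : ℕ → P | ∀ k ≤ n, φ k ∉ B} := by
    convert! MeasurableSet.iInter fun k => MeasurableSet.iInter fun (_ : k ≤ n) =>
      hB.measurableSet.compl.preimage (measurable_pi_apply (X := fun _ : ℕ => P) k) using 1
    ext φ
    simp
  obtain ⟨B₁, hAB₁, hB₁, hinj⟩ := ((hC.inter hU.analyticSet).image_of_continuous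
    (continuous_apply i)).exists_measurableSet_injOn hp <| by
      rintro _ ⟨φ, ⟨hφC, hφB⟩, rfl⟩ _ ⟨φ', ⟨hφC', hφB'⟩, rfl⟩ h
      by_contra hne
      obtain ⟨k, hk, hkB⟩ := hBC _ ⟨(φ, φ'), ⟨⟨hφC, hφC'⟩, h, hne⟩, rfl⟩
      obtain hk | rfl := Nat.le_succ_iff.1 hk
      · exact hφB k hk (by simpa [update_of_ne (show k ≠ n + 1 by omega)] using hkB)
      · exact hφB' i hi (by simpa using hkB)
  refine hlarge ⟨B ∪ B₁, hB.union (.of_injOn hB₁ hinj), fun φ hφ => ?_⟩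
  by_cases h : ∃ k ≤ n, φ k ∈ B
  · obtain ⟨k, hk, hkB⟩ := h
    exact ⟨k, hk, .inl hkB⟩
  · push Not at h
    exact ⟨i, hi, .inr (hAB₁ ⟨φ, ⟨hφ, h⟩, rfl⟩)⟩

end LusinNovikov

section Construction

variable {P X : Type*} [MetricSpace P] [CompleteSpace P] [SecondCountableTopology P]
  [MeasurableSpace P] [BorelSpace P] [TopologicalSpace X] [T2Space X] {p : P → X}

lemma exists_large_subset_splitting (hp : Continuous p) {C : Set (ℕ → P)} (hC : AnalyticSet C)
    {n i : ℕ} (hi : i ≤ n) (hlarge : ¬ IsSmallUpTo p n C) {ε : ℝ} (hε : 0 < ε) :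
    ∃ D ⊆ splitting p n i C, AnalyticSet D ∧ ¬ IsSmallUpTo p (n + 1) D ∧
      (∀ φ ∈ D, ∀ φ' ∈ D, ∀ k ≤ n + 1, dist (φ k) (φ' k) ≤ ε) ∧
      ∃ δ > 0, ∀ φ ∈ D, δ ≤ dist (φ i) (φ (n + 1)) := by
  have : Nonempty P := by
    by_contra h
    exact hlarge ⟨∅, .of_injOn .empty (injOn_empty _), fun φ => (h ⟨φ 0⟩).elim⟩
  let d := TopologicalSpace.denseSeq P
  let S : (Fin (n + 2) → ℕ) × ℕ → Set (ℕ → P) := fun a =>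
    (⋂ k : Fin (n + 2), {φ | dist (φ k) (d (a.1 k)) ≤ ε / 2}) ∩
      {φ | 1 / ((a.2 : ℝ) + 1) ≤ dist (φ i) (φ (n + 1))}
  have hS : ∀ a, IsClosed (S a) := fun a =>
    (isClosed_iInter fun k => isClosed_le (by fun_prop) continuous_const).inter
      (isClosed_le continuous_const (by fun_prop))
  obtain ⟨a, ha⟩ : ∃ a, ¬ IsSmallUpTo p (n + 1) (splitting p n i C ∩ S a) := by
    by_contra! h
    obtain ⟨B, hB, hBC⟩ := IsSmallUpTo.iUnion h
    refine not_isSmallUpTo_splitting hp hC hi hlarge ⟨B, hB, fun φ hφ => hBC φ ?_⟩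
    have hne : 0 < dist (φ i) (φ (n + 1)) := by
      obtain ⟨-, -, -, -, -, -, -, hne⟩ := exists_eq_of_mem_splitting hi hφ
      exact dist_pos.2 hne
    obtain ⟨m, hm⟩ := exists_nat_one_div_lt hne
    have hd : ∀ k : Fin (n + 2), ∃ j, dist (φ k) (d j) ≤ ε / 2 := fun k => by
      obtain ⟨j, hj⟩ := (TopologicalSpace.denseRange_denseSeq P).exists_dist_lt (φ k)
        (half_pos hε)
      exact ⟨j, hj.le⟩
    choose c hc using hd
    exact mem_iUnion.2 ⟨(c, m), hφ, mem_iInter.2 hc, hm.le⟩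
  refine ⟨_, inter_subset_left, (hC.splitting hp n i).inter (hS a).analyticSet, ha, ?_,
    1 / ((a.2 : ℝ) + 1), by positivity, fun φ hφ => hφ.2.2⟩
  rintro φ ⟨-, hφ, -⟩ φ' ⟨-, hφ', -⟩ k hk
  have h : dist (φ k) _ ≤ _ := mem_iInter.1 hφ ⟨k, by omega⟩
  have h' : dist (φ' k) _ ≤ _ := mem_iInter.1 hφ' ⟨k, by omega⟩
  linarith [dist_triangle_right (φ k) (φ' k) (d (a.1 ⟨k, by omega⟩))]

lemma exists_seq_subset_splitting (hp : Continuous p) (hlarge : ¬ CountablyInjOn p (univ : Set P)) :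
    ∃ C : ℕ → Set (ℕ → P), (∀ n, (C n).Nonempty) ∧
      (∀ n, C (n + 1) ⊆ splitting p n n.unpair.1 (C n)) ∧
      (∀ r > 0, ∃ N, ∀ n ≥ N, ∀ φ ∈ C n, ∀ φ' ∈ C n, ∀ k ≤ n, dist (φ k) (φ' k) < r) ∧
      ∀ n, ∃ δ > 0, ∀ φ ∈ C (n + 1), δ ≤ dist (φ n.unpair.1) (φ (n + 1)) := by
  choose next hsub hanalytic hnext hdiam hsep using
    fun (n : ℕ) (C : {C : Set (ℕ → P) // AnalyticSet C ∧ ¬ IsSmallUpTo p n C}) =>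
      exists_large_subset_splitting hp C.2.1 n.unpair_left_le C.2.2
        (Nat.one_div_pos_of_nat (α := ℝ) (n := n))
  have h₀ : ¬ IsSmallUpTo p 0 (univ : Set (ℕ → P)) := by
    rintro ⟨B, hB, h⟩
    refine hlarge (eq_univ_of_forall (s := B) (fun x => ?_) ▸ hB)
    obtain ⟨k, -, hk⟩ := h (fun _ => x) (mem_univ _)
    exact hk
  let C (n : ℕ) : {C : Set (ℕ → P) // AnalyticSet C ∧ ¬ IsSmallUpTo p n C} :=
    Nat.rec ⟨univ, isClosed_univ.analyticSet, h₀⟩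
      (fun n C => ⟨next n C, hanalytic n C, hnext n C⟩) n
  refine ⟨fun n => (C n).1, fun n => ?_, fun n => hsub n (C n), fun r hr => ?_, fun n => hsep n (C n)⟩
  · by_contra h
    refine (C n).2.2 ⟨∅, .of_injOn .empty (injOn_empty _), fun φ hφ => (h ⟨φ, hφ⟩).elim⟩
  · obtain ⟨N, hN⟩ := exists_nat_one_div_lt hr
    refine ⟨N + 1, fun n hn φ hφ φ' hφ' k hk => ?_⟩
    obtain ⟨n, rfl⟩ := Nat.exists_eq_add_of_le' (show 1 ≤ n by omega)
    exact (hdiam n (C n) φ hφ φ' hφ' k hk).trans_lt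
      ((Nat.one_div_le_one_div (by omega)).trans_lt hN)

end Construction

lemma exists_preperfect_range_of_seq {P X : Type*} [MetricSpace P] [CompleteSpace P]
    [TopologicalSpace X] [T2Space X] {p : P → X} (hp : Continuous p) {C : ℕ → Set (ℕ → P)}
    (hne : ∀ n, (C n).Nonempty) (hsub : ∀ n, C (n + 1) ⊆ splitting p n n.unpair.1 (C n))
    (hdiam : ∀ r > 0, ∃ N, ∀ n ≥ N, ∀ φ ∈ C n, ∀ φ' ∈ C n, ∀ k ≤ n, dist (φ k) (φ' k) < r)
    (hsep : ∀ n, ∃ δ > 0, ∀ φ ∈ C (n + 1), δ ≤ dist (φ n.unpair.1) (φ (n + 1))) :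
    ∃ z : ℕ → P, (∀ k, p (z k) = p (z 0)) ∧ Preperfect (range z) := by
  have hsplit := fun n φ (hφ : φ ∈ C (n + 1)) =>
    exists_eq_of_mem_splitting n.unpair_left_le (hsub n hφ)
  have hrestrict : ∀ n m, n ≤ m → ∀ ψ ∈ C m, ∃ φ ∈ C n, ∀ k ≤ n, ψ k = φ k := by
    intro n m hnm
    induction m, hnm using Nat.le_induction with
    | base => exact fun ψ hψ => ⟨ψ, hψ, fun _ _ => rfl⟩
    | succ m hnm ih =>
      intro ψ hψ
      obtain ⟨φ, hφ, -, -, h, -⟩ := hsplit m ψ hψ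
      obtain ⟨χ, hχ, h'⟩ := ih φ hφ
      exact ⟨χ, hχ, fun k hk => (h k (hk.trans hnm)).trans (h' k hk)⟩
  have hconst : ∀ n, ∀ φ ∈ C n, ∀ k ≤ n, p (φ k) = p (φ 0) := by
    intro n
    induction n with
    | zero =>
      intro φ _ k hk
      rw [Nat.le_zero.1 hk]
    | succ n ih =>
      intro ψ hψ
      obtain ⟨φ, hφ, -, -, h, -, hpn, -⟩ := hsplit n ψ hψ
      have hle : ∀ k ≤ n, p (ψ k) = p (ψ 0) := fun k hk => by
        rw [h k hk, h 0 n.zero_le, ih φ hφ k hk]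
      intro k hk
      obtain hk | rfl := Nat.le_succ_iff.1 hk
      · exact hle k hk
      · exact hpn.trans (hle _ n.unpair_left_le)
  choose φ hφ using hne
  have hcauchy : ∀ k, CauchySeq fun n => φ n k := fun k => by
    refine Metric.cauchySeq_iff'.2 fun r hr => ?_
    obtain ⟨N, hN⟩ := hdiam r hr
    refine ⟨max N k, fun n hn => ?_⟩
    obtain ⟨χ, hχ, h⟩ := hrestrict _ _ hn _ (hφ n)
    rw [h k (le_max_right _ _)]
    exact hN _ (le_max_left _ _) χ hχ _ (hφ _) k (le_max_right _ _)
  choose z hz using fun k => cauchySeq_tendsto_of_complete (hcauchy k)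
  refine ⟨z, fun k => ?_, preperfect_iff_nhds.2 ?_⟩
  · refine tendsto_nhds_unique_of_eventuallyEq ((hp.tendsto _).comp (hz k))
      ((hp.tendsto _).comp (hz 0)) ?_
    filter_upwards [eventually_ge_atTop k] with n hn using hconst n _ (hφ n) k hn
  rintro _ ⟨i, rfl⟩ U hU
  obtain ⟨r, hr, hrU⟩ := Metric.nhds_basis_closedBall.mem_iff.1 hU
  obtain ⟨N, hN⟩ := hdiam r hr
  set n := Nat.pair i N with hn
  have hni : n.unpair.1 = i := by simp [hn]
  have hdist : Tendsto (fun m => dist (φ m i) (φ m (n + 1))) atTop (𝓝 (dist (z i) (z (n + 1)))) :=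
    (hz i).dist (hz (n + 1))
  refine ⟨z (n + 1), ⟨hrU ?_, mem_range_self _⟩, fun h => ?_⟩
  · rw [Metric.mem_closedBall']
    refine le_of_tendsto hdist ?_
    filter_upwards [eventually_ge_atTop (n + 1)] with m hm
    obtain ⟨χ, hχ, h⟩ := hrestrict _ _ hm _ (hφ m)
    obtain ⟨θ, hθ, θ', hθ', hθi, hθn, -⟩ := hsplit n χ hχ
    have hin : i ≤ n := Nat.left_le_pair i N
    rw [h i (by omega), h _ le_rfl, hθn, hθi i hin, hni]
    exact (hN n (Nat.right_le_pair i N) θ hθ θ' hθ' i hin).le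
  · obtain ⟨δ, hδ, hle⟩ := hsep n
    rw [h, dist_self] at hdist
    refine hδ.not_ge (ge_of_tendsto hdist ?_)
    filter_upwards [eventually_ge_atTop (n + 1)] with m hm
    obtain ⟨χ, hχ, h⟩ := hrestrict _ _ hm _ (hφ m)
    rw [h i (by have := Nat.left_le_pair i N; omega), h _ le_rfl]
    exact hni ▸ hle χ hχ

/-- **Lusin–Novikov theorem** for continuous maps: the domain of a countable-to-one continuous map
is a countable union of measurable sets on which the map is injective. -/
lemma Continuous.countablyInjOn_univ {P X : Type*} [TopologicalSpace P] [PolishSpace P]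
    [MeasurableSpace P] [BorelSpace P] [TopologicalSpace X] [T2Space X] {p : P → X}
    (hp : Continuous p) (hcount : ∀ x, (p ⁻¹' {x}).Countable) :
    CountablyInjOn p (univ : Set P) := by
  let := TopologicalSpace.upgradeIsCompletelyMetrizable P
  by_contra hlarge
  obtain ⟨C, hne, hsub, hdiam, hsep⟩ := exists_seq_subset_splitting hp hlarge
  obtain ⟨z, hz, hperf⟩ := exists_preperfect_range_of_seq hp hne hsub hdiam hsep
  obtain ⟨f, hf, -, hinj⟩ :=
    hperf.perfect_closure.exists_nat_bool_injection (range_nonempty z).closure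
  have hfibre : closure (range z) ⊆ p ⁻¹' {p (z 0)} :=
    closure_minimal (range_subset_iff.2 hz) (isClosed_singleton.preimage hp)
  have : (range f).Countable := (hcount _).mono (hf.trans hfibre)
  have hunc : Uncountable (ℕ → Bool) := by
    rw [← Cardinal.aleph0_lt_mk_iff]
    simp [Cardinal.aleph0_lt_continuum]
  have := this.to_subtype
  exact not_countable (α := ℕ → Bool) (rangeFactorization_injective.2 hinj).countable

/-- **Lusin–Novikov theorem**: the domain of a countable-to-one measurable map between standard
Borel spaces is a countable union of measurable sets on which the map is injective. -/
lemma Measurable.countablyInjOn_univ {P X : Type*} [MeasurableSpace P] [StandardBorelSpace P]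
    [MeasurableSpace X] [StandardBorelSpace X] {p : P → X}
    (hp : Measurable p) (hcount : ∀ x, (p ⁻¹' {x}).Countable) :
    CountablyInjOn p (univ : Set P) := by
  let := upgradeStandardBorel X
  obtain ⟨τ, hτ, hτ'⟩ := StandardBorelSpace.polish (α := P)
  obtain ⟨t, hle, hcont, ht⟩ := hp.exists_continuous
  have hB : @BorelSpace P t _ := ⟨by rw [borel_eq_borel_of_le ht hτ' hle]; exact hτ.measurable_eq⟩
  exact @Continuous.countablyInjOn_univ P X t ht _ hB _ _ p hcont hcount

/-- A measurable binary relation which is symmetric and single-valued is the graph of a measurable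
involution outside of the diagonal. -/
lemma exists_measurable_involution_of_graph {X : Type*} [MeasurableSpace X] [StandardBorelSpace X]
    {H : Set (X × X)} (hH : MeasurableSet H) (hsymm : ∀ x y, (x, y) ∈ H → (y, x) ∈ H)
    (huniq : ∀ x y z, (x, y) ∈ H → (x, z) ∈ H → y = z) :
    ∃ g : X ≃ X, Measurable g ∧ Measurable g.symm ∧ (∀ x, g x = x ∨ (x, g x) ∈ H) ∧
      ∀ x y, (x, y) ∈ H → g x = y := by
  classical
  let g : X → X := fun x => if h : ∃ y, (x, y) ∈ H then h.choose else x
  have hg : ∀ x y, (x, y) ∈ H → g x = y := fun x y h => by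
    have hx : ∃ y, (x, y) ∈ H := ⟨y, h⟩
    simp only [g, dif_pos hx]
    exact huniq x _ _ hx.choose_spec h
  have hg' : ∀ x, (∀ y, (x, y) ∉ H) → g x = x := fun x h => dif_neg (not_exists.2 h)
  have hinv : Involutive g := fun x => by
    by_cases h : ∃ y, (x, y) ∈ H
    · obtain ⟨y, hy⟩ := h
      rw [hg x y hy, hg y x (hsymm x y hy)]
    · push Not at h
      rw [hg' x h, hg' x h]
  have hinj : InjOn Prod.fst H := by
    rintro ⟨x, y⟩ h ⟨_, z⟩ h' rfl
    rw [huniq x y z h h']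
  have himage : ∀ {K : Set (X × X)}, MeasurableSet K → K ⊆ H → MeasurableSet (Prod.fst '' K) :=
    fun hK hKH => hK.image_of_measurable_injOn measurable_fst (hinj.mono hKH)
  have hmeas : Measurable g := fun S hS => by
    convert! (himage (hH.inter (measurable_snd hS)) inter_subset_left).union
      (hS.diff (himage hH subset_rfl)) using 1
    ext x
    by_cases h : ∃ y, (x, y) ∈ H
    · obtain ⟨y, hy⟩ := h
      have : ∀ z, (x, z) ∈ H ↔ z = y := fun z => ⟨fun h => huniq x z y h hy, fun h => h ▸ hy⟩
      simp [hg x y hy, this]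
    · push Not at h
      simp [hg' x h, h]
  refine ⟨hinv.toPerm, hmeas, hmeas, fun x => ?_, hg⟩
  by_cases h : ∃ y, (x, y) ∈ H
  · obtain ⟨y, hy⟩ := h
    exact .inr (by rwa [Involutive.coe_toPerm, hg x y hy])
  · exact .inl (hg' x (not_exists.1 h))

/-- A measurable relation with countable sections is the union of countably many graphs of
measurable partial functions. -/
lemma MeasurableSet.exists_iUnion_graph {X Y : Type*} [MeasurableSpace X] [StandardBorelSpace X]
    [MeasurableSpace Y] [StandardBorelSpace Y] {R : Set (X × Y)} (hR : MeasurableSet R)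
    (hcount : ∀ x, {y | (x, y) ∈ R}.Countable) :
    ∃ B : ℕ → Set (X × Y), (∀ n, MeasurableSet (B n) ∧ InjOn Prod.fst (B n)) ∧ R = ⋃ n, B n := by
  have := hR.standardBorel
  obtain ⟨S, hS, hSR⟩ := Measurable.countablyInjOn_univ (P := R) (p := fun q => q.1.1)
    (measurable_fst.comp measurable_subtype_coe) fun x => by
      refine MapsTo.countable_of_injOn (f := fun q : R => q.1.2) (t := {y | (x, y) ∈ R}) ?_ ?_
        (hcount x)
      · rintro ⟨⟨_, y⟩, h⟩ rfl
        exact h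
      · rintro ⟨⟨_, y⟩, h⟩ rfl ⟨⟨_, z⟩, h'⟩ hz hyz
        exact Subtype.ext (Prod.ext hz.symm hyz)
  refine ⟨fun n => Subtype.val '' S n, fun n => ⟨hR.subtype_image (hS n).1, ?_⟩, ?_⟩
  · rintro _ ⟨q, hq, rfl⟩ _ ⟨q', hq', rfl⟩ h
    exact congrArg _ ((hS n).2 hq hq' h)
  · rw [← image_iUnion, ← hSR, image_univ, Subtype.range_coe]


/-- Every countable Borel equivalence relation is the union of the graphs of countably many
Borel bijections of the underlying space. -/
theorem stmt_3 {X : Type*} [MeasurableSpace X] [StandardBorelSpace X]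
    (E : X → X → Prop) (hE : Equivalence E)
    (hBorel : MeasurableSet {p : X × X | E p.1 p.2})
    (hcount : ∀ x : X, {y : X | E x y}.Countable) :
    ∃ g : ℕ → X ≃ X, (∀ n, Measurable ⇑(g n)) ∧ (∀ n, Measurable ⇑(g n).symm) ∧
      ∀ x y : X, E x y ↔ ∃ n, g n x = y := by
  have hcount' : ∀ x, {y | (x, y) ∈ {p : X × X | E p.1 p.2}}.Countable := hcount
  obtain ⟨B, hB, hEB⟩ := hBorel.exists_iUnion_graph hcount'
  have hBE : ∀ {n x y}, (x, y) ∈ B n → E x y := fun {n x y} h =>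
    show (x, y) ∈ {p : X × X | E p.1 p.2} from hEB ▸ mem_iUnion_of_mem n h
  have hEB : ∀ {x y}, E x y → ∃ n, (x, y) ∈ B n := fun {x y} h => by
    have : (x, y) ∈ {p : X × X | E p.1 p.2} := h
    rwa [hEB, mem_iUnion] at this
  let e := embeddingReal X
  have he : Measurable e := measurable_embeddingReal X
  let F : ℕ × ℕ × ℚ → Set (X × X) := fun a =>
    {q | (q ∈ B a.1 ∧ q.swap ∈ B a.2.1) ∧ e q.1 < a.2.2 ∧ a.2.2 < e q.2}
  have hF : ∀ a, MeasurableSet (F a) := fun a =>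
    ((hB _).1.inter (measurable_swap (hB _).1)).inter
      ((measurableSet_lt (he.comp measurable_fst) measurable_const).inter
        (measurableSet_lt measurable_const (he.comp measurable_snd)))
  have hinv : ∀ a, _ := fun a => exists_measurable_involution_of_graph
    (H := F a ∪ Prod.swap ⁻¹' F a) ((hF a).union (measurable_swap (hF a)))
    (fun x y h => h.symm) <| by
      rintro x y z (⟨⟨h₁, h₂⟩, h₃, h₄⟩ | ⟨⟨h₁, h₂⟩, h₃, h₄⟩)
        (⟨⟨k₁, k₂⟩, k₃, k₄⟩ | ⟨⟨k₁, k₂⟩, k₃, k₄⟩)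
      · exact congrArg Prod.snd ((hB _).2 h₁ k₁ rfl)
      · exact (lt_asymm h₃ k₄).elim
      · exact (lt_asymm k₃ h₄).elim
      · exact congrArg Prod.snd ((hB _).2 h₂ k₂ rfl)
  choose g hg hg' hgF hFg using hinv
  have hgE : ∀ a x, E x (g a x) := fun a x => by
    obtain h | h | h := hgF a x
    · rw [h]
      exact hE.refl x
    · exact hBE h.1.1
    · exact hBE h.1.2
  have hlt : ∀ {x y}, E x y → e x < e y → ∃ a, (x, y) ∈ F a := fun {x y} h hxy => by
    obtain ⟨n, hn⟩ := hEB h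
    obtain ⟨m, hm⟩ := hEB (hE.symm h)
    obtain ⟨r, hr⟩ := exists_rat_btwn hxy
    exact ⟨(n, m, r), ⟨hn, hm⟩, hr⟩
  obtain ⟨f, hf⟩ := exists_surjective_nat (Option (ℕ × ℕ × ℚ))
  let g' : Option (ℕ × ℕ × ℚ) → X ≃ X := fun a => a.elim (Equiv.refl X) g
  refine ⟨fun n => g' (f n), fun n => ?_, fun n => ?_, fun x y => ?_⟩
  · change Measurable (g' (f n))
    cases f n with
    | none => exact measurable_id
    | some a => exact hg a
  · change Measurable (g' (f n)).symm
    cases f n with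
    | none => exact measurable_id
    | some a => exact hg' a
  change E x y ↔ ∃ n, g' (f n) x = y
  rw [← hf.exists (p := fun a => g' a x = y)]
  refine ⟨fun h => ?_, ?_⟩
  · obtain hxy | hxy | hxy := lt_trichotomy (e x) (e y)
    · obtain ⟨a, ha⟩ := hlt h hxy
      exact ⟨some a, hFg a x y (.inl ha)⟩
    · exact ⟨none, (measurableEmbedding_embeddingReal X).injective hxy⟩
    · obtain ⟨a, ha⟩ := hlt (hE.symm h) hxy
      exact ⟨some a, hFg a x y (.inr ha)⟩
  · rintro ⟨_ | a, rfl⟩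
    · exact hE.refl x
    · exact hgE a x
end

section
/- Let X be a standard Borel space, A ⊆ X a Borel set, and f : X → X a Borel function whose restriction to A is injective. Then there exist two Borel bijections g, h of X (bijections with g, g⁻¹, h, h⁻¹ Borel) such that for every x ∈ A, f x = g x or f x = h x. (Every Borel partial injection on a standard Borel space is contained in the union of two Borel bijections.) -/
open Set

/-- If `q` is the shift of a decreasing sequence `p` of propositions that is eventually false, then
the first failures of `p` and `q` occur at indices of opposite parity. -/
theorem exists_even_drop_shift_iff {p q : ℕ → Prop} (hp : Antitone p) (hp0 : p 0) (hq0 : q 0)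
    (hpq : ∀ k, q (k + 1) ↔ p k) (hfail : ∃ k, ¬ p k) :
    (∃ n, q (2 * n) ∧ ¬ q (2 * n + 1)) ↔ ¬ ∃ n, p (2 * n) ∧ ¬ p (2 * n + 1) := by
  classical
  obtain ⟨N, hN⟩ : ∃ N, ∀ k, p k ↔ k < N := by
    refine ⟨Nat.find hfail, fun k => ⟨fun hk => ?_, fun hk => not_not.1 (Nat.find_min hfail hk)⟩⟩
    by_contra! h
    exact Nat.find_spec hfail (hp h hk)
  have hq : ∀ k, q k ↔ k < N + 1 := by
    rintro (_ | k)
    · simp [hq0]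
    · rw [hpq, hN]; omega
  have hN0 : 0 < N := (hN 0).1 hp0
  simp only [hN, hq]
  constructor
  · rintro ⟨n, hn⟩ ⟨m, hm⟩
    omega
  · intro h
    refine ⟨N / 2, by omega, fun hlt => h ⟨(N - 1) / 2, ?_⟩⟩
    omega

section

variable {X : Type*} [MeasurableSpace X] [StandardBorelSpace X] {f : X → X}

/-- A Borel injection moving `S` off itself extends to a Borel involution supported on
`S ∪ f '' S`. -/
theorem exists_measurable_involution_extending (hf : Measurable f) {S : Set X}
    (hS : MeasurableSet S) (hinj : InjOn f S) (hdisj : ∀ x ∈ S, f x ∉ S) :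
    ∃ e : X ≃ X, Measurable e ∧ Measurable e.symm ∧ (∀ x ∈ S, e x = f x) ∧
      ∀ x ∉ S, x ∉ f '' S → e x = x := by
  classical
  let u : X → X := fun x =>
    if x ∈ S then f x else if h : x ∈ f '' S then h.choose else x
  have hu1 : ∀ x ∈ S, u x = f x := fun x hx => if_pos hx
  have hu2 : ∀ x ∈ S, u (f x) = x := fun x hx => by
    have h : f x ∈ f '' S := mem_image_of_mem f hx
    have : u (f x) = h.choose := by simp only [u, if_neg (hdisj x hx), dif_pos h]
    rw [this]
    exact hinj h.choose_spec.1 hx h.choose_spec.2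
  have hu3 : ∀ x ∉ S, x ∉ f '' S → u x = x := fun x hx hx' => by
    simp only [u, if_neg hx, dif_neg hx']
  have hinv : Function.Involutive u := fun x => by
    by_cases hx : x ∈ S
    · rw [hu1 x hx, hu2 x hx]
    by_cases hx' : x ∈ f '' S
    · obtain ⟨y, hy, rfl⟩ := hx'
      rw [hu2 y hy, hu1 y hy]
    · rw [hu3 x hx hx', hu3 x hx hx']
  have hmeas : Measurable u := fun U hU => by
    have : u ⁻¹' U = (S ∩ f ⁻¹' U) ∪ f '' (S ∩ U) ∪ (U \ (S ∪ f '' S)) := by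
      ext x
      by_cases hx : x ∈ S
      · have : x ∉ f '' (S ∩ U) := by
          rintro ⟨y, hy, rfl⟩
          exact hdisj y hy.1 hx
        simp [hx, this, hu1 x hx]
      by_cases hx' : x ∈ f '' S
      · obtain ⟨y, hy, rfl⟩ := hx'
        have : f y ∈ f '' (S ∩ U) ↔ y ∈ U := by
          refine ⟨?_, fun h => ⟨y, ⟨hy, h⟩, rfl⟩⟩
          rintro ⟨z, hz, hzy⟩
          exact hinj hz.1 hy hzy ▸ hz.2
        rw [mem_preimage, hu2 y hy, mem_union, mem_union, this]
        simp [hx, mem_image_of_mem f hy]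
      · have : x ∉ f '' (S ∩ U) := fun h => hx' (image_mono inter_subset_left h)
        rw [mem_preimage, hu3 x hx hx', mem_union, mem_union, mem_sdiff, mem_union]
        simp [hx, hx', this, -mem_image]
    rw [this]
    exact ((hS.inter (hf hU)).union
      ((hS.inter hU).image_of_measurable_injOn hf (hinj.mono inter_subset_left))).union
      (hU.diff (hS.union (hS.image_of_measurable_injOn hf hinj)))
  exact ⟨hinv.toPerm u, hmeas, hmeas, hu1, hu3⟩

/-- A Borel permutation of a Borel set `C` extends by the identity to a Borel permutation of the
whole space. -/
theorem exists_measurable_equiv_extending_bijOn (hf : Measurable f) {C : Set X}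
    (hC : MeasurableSet C) (hbij : BijOn f C C) :
    ∃ e : X ≃ X, Measurable e ∧ Measurable e.symm ∧ (∀ x ∈ C, e x = f x) ∧
      ∀ x ∉ C, e x = x := by
  classical
  let u : X → X := C.piecewise f id
  have hu1 : ∀ x ∈ C, u x = f x := fun x hx => piecewise_eq_of_mem _ _ _ hx
  have hu2 : ∀ x ∉ C, u x = x := fun x hx => piecewise_eq_of_notMem _ _ _ hx
  have hmeas : Measurable u := hf.piecewise hC measurable_id
  have hu : Function.Bijective u := by
    constructor
    · intro x y hxy
      by_cases hx : x ∈ C <;> by_cases hy : y ∈ C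
      · rw [hu1 x hx, hu1 y hy] at hxy
        exact hbij.injOn hx hy hxy
      · rw [hu1 x hx, hu2 y hy] at hxy
        exact absurd (hxy ▸ hbij.mapsTo hx) hy
      · rw [hu2 x hx, hu1 y hy] at hxy
        exact absurd (hxy ▸ hbij.mapsTo hy) hx
      · rwa [hu2 x hx, hu2 y hy] at hxy
    · intro y
      by_cases hy : y ∈ C
      · obtain ⟨x, hx, rfl⟩ := hbij.surjOn hy
        exact ⟨x, hu1 x hx⟩
      · exact ⟨y, hu2 y hy⟩
  refine ⟨Equiv.ofBijective u hu, hmeas, fun U hU => ?_, hu1, hu2⟩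
  rw [← Equiv.image_eq_preimage_symm]
  exact hU.image_of_measurable_injOn hmeas hu.1.injOn

theorem exists_measurable_equiv_extending_union (hf : Measurable f) {C S : Set X}
    (hC : MeasurableSet C) (hS : MeasurableSet S) (hbij : BijOn f C C) (hinj : InjOn f S)
    (hdisj : ∀ x ∈ S, f x ∉ S) (hSC : ∀ x ∈ S, x ∉ C) (hfSC : ∀ x ∈ S, f x ∉ C) :
    ∃ e : X ≃ X, Measurable e ∧ Measurable e.symm ∧ ∀ x ∈ C ∪ S, e x = f x := by
  obtain ⟨r, hr, hr', hrC, hrC'⟩ := exists_measurable_equiv_extending_bijOn hf hC hbij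
  obtain ⟨s, hs, hs', hsS, hsS'⟩ := exists_measurable_involution_extending hf hS hinj hdisj
  refine ⟨r.trans s, hs.comp hr, hr'.comp hs', ?_⟩
  rintro x (hx | hx)
  · have hfx := hbij.mapsTo hx
    rw [Equiv.trans_apply, hrC x hx]
    refine hsS' _ (fun h => hSC _ h hfx) ?_
    rintro ⟨y, hy, hyx⟩
    exact hfSC y hy (hyx ▸ hfx)
  · rw [Equiv.trans_apply, hrC' x (hSC x hx), hsS x hx]

end

/-- The points admitting at least `n` backward steps along the restriction of `f` to `A`. -/
def backwardReach {X : Type*} (f : X → X) (A : Set X) : ℕ → Set X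
  | 0 => univ
  | n + 1 => f '' (A ∩ backwardReach f A n)

/-- The points admitting at least `n` forward steps along the restriction of `f` to `A`. -/
def forwardReach {X : Type*} (f : X → X) (A : Set X) : ℕ → Set X
  | 0 => univ
  | n + 1 => A ∩ f ⁻¹' forwardReach f A n

section

variable {X : Type*} {f : X → X} {A : Set X}

theorem backwardReach_antitone : Antitone (backwardReach f A) := by
  refine antitone_nat_of_succ_le fun n => ?_
  induction n with
  | zero => exact subset_univ _
  | succ n ih => exact image_mono (inter_subset_inter_right _ ih)

theorem forwardReach_antitone : Antitone (forwardReach f A) := by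
  refine antitone_nat_of_succ_le fun n => ?_
  induction n with
  | zero => exact subset_univ _
  | succ n ih => exact inter_subset_inter_right _ (preimage_mono ih)

theorem apply_mem_backwardReach_succ_iff (hinj : InjOn f A) {x : X} (hx : x ∈ A) (n : ℕ) :
    f x ∈ backwardReach f A (n + 1) ↔ x ∈ backwardReach f A n := by
  refine ⟨?_, fun h => ⟨x, ⟨hx, h⟩, rfl⟩⟩
  rintro ⟨y, hy, hyx⟩
  exact hinj hy.1 hx hyx ▸ hy.2

theorem mem_forwardReach_succ_iff {x : X} (hx : x ∈ A) (n : ℕ) :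
    x ∈ forwardReach f A (n + 1) ↔ f x ∈ forwardReach f A n :=
  and_iff_right hx

theorem apply_mem_iInter_backwardReach_iff (hinj : InjOn f A) {x : X} (hx : x ∈ A) :
    f x ∈ ⋂ n, backwardReach f A n ↔ x ∈ ⋂ n, backwardReach f A n := by
  simp only [mem_iInter]
  refine ⟨fun h n => (apply_mem_backwardReach_succ_iff hinj hx n).1 (h _), fun h n => ?_⟩
  exact backwardReach_antitone n.le_succ ((apply_mem_backwardReach_succ_iff hinj hx n).2 (h n))

theorem apply_mem_iInter_forwardReach_iff {x : X} (hx : x ∈ A) :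
    f x ∈ ⋂ n, forwardReach f A n ↔ x ∈ ⋂ n, forwardReach f A n := by
  simp only [mem_iInter]
  refine ⟨fun h n => ?_, fun h n => (mem_forwardReach_succ_iff hx n).1 (h _)⟩
  exact forwardReach_antitone n.le_succ ((mem_forwardReach_succ_iff hx n).2 (h n))

theorem measurableSet_backwardReach [MeasurableSpace X] [StandardBorelSpace X]
    (hA : MeasurableSet A) (hf : Measurable f) (hinj : InjOn f A) (n : ℕ) :
    MeasurableSet (backwardReach f A n) := by
  induction n with
  | zero => exact MeasurableSet.univ
  | succ n ih =>
    exact (hA.inter ih).image_of_measurable_injOn hf (hinj.mono inter_subset_left)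

theorem measurableSet_forwardReach [MeasurableSpace X]
    (hA : MeasurableSet A) (hf : Measurable f) (n : ℕ) :
    MeasurableSet (forwardReach f A n) := by
  induction n with
  | zero => exact MeasurableSet.univ
  | succ n ih => exact hA.inter (hf ih)

/-- The points lying on a two-sided (periodic or bi-infinite) orbit of the restriction of `f`
to `A`. -/
def twoSidedPart (f : X → X) (A : Set X) : Set X :=
  (⋂ n, backwardReach f A n) ∩ ⋂ n, forwardReach f A n

theorem apply_mem_twoSidedPart_iff (hinj : InjOn f A) {x : X} (hx : x ∈ A) :
    f x ∈ twoSidedPart f A ↔ x ∈ twoSidedPart f A :=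
  and_congr (apply_mem_iInter_backwardReach_iff hinj hx) (apply_mem_iInter_forwardReach_iff hx)

theorem twoSidedPart_subset : twoSidedPart f A ⊆ A :=
  fun _ hx => (mem_iInter.1 hx.2 1).1

theorem bijOn_twoSidedPart (hinj : InjOn f A) :
    BijOn f (twoSidedPart f A) (twoSidedPart f A) := by
  refine ⟨fun x hx => (apply_mem_twoSidedPart_iff hinj (twoSidedPart_subset hx)).2 hx,
    hinj.mono twoSidedPart_subset, fun y hy => ?_⟩
  obtain ⟨x, ⟨hxA, -⟩, rfl⟩ := mem_iInter.1 hy.1 1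
  exact ⟨x, (apply_mem_twoSidedPart_iff hinj hxA).1 hy, rfl⟩

/-- The points at even distance from the initial point of their orbit, or from its final point if
there is no initial point. -/
def evenPart (f : X → X) (A : Set X) : Set X :=
  ((⋂ n, backwardReach f A n) ∩ ⋃ n, forwardReach f A (2 * n) \ forwardReach f A (2 * n + 1)) ∪
    ((⋂ n, backwardReach f A n)ᶜ ∩
      ⋃ n, backwardReach f A (2 * n) \ backwardReach f A (2 * n + 1))

theorem apply_mem_evenPart_iff (hinj : InjOn f A) {x : X} (hx : x ∈ A)
    (hxC : x ∉ twoSidedPart f A) : f x ∈ evenPart f A ↔ x ∉ evenPart f A := by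
  have hB := apply_mem_iInter_backwardReach_iff hinj hx
  by_cases hxB : x ∈ ⋂ n, backwardReach f A n
  · have hfail : ∃ k, f x ∉ forwardReach f A k := by
      by_contra! h
      exact hxC ⟨hxB, (apply_mem_iInter_forwardReach_iff hx).1 (mem_iInter.2 h)⟩
    have key := exists_even_drop_shift_iff
      (p := fun k => f x ∈ forwardReach f A k) (q := fun k => x ∈ forwardReach f A k)
      (fun _ _ h hx => forwardReach_antitone h hx) (mem_univ _) (mem_univ _)
      (mem_forwardReach_succ_iff hx) hfail
    simp only [evenPart, mem_union, mem_inter_iff, mem_compl_iff, hB, hxB, true_and, not_true,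
      false_and, or_false, mem_iUnion (s := fun n => _ \ _), mem_sdiff]
    exact iff_not_comm.1 key
  · have hfail : ∃ k, x ∉ backwardReach f A k := by
      simpa only [mem_iInter, not_forall] using hxB
    have key := exists_even_drop_shift_iff
      (p := fun k => x ∈ backwardReach f A k) (q := fun k => f x ∈ backwardReach f A k)
      (fun _ _ h hx => backwardReach_antitone h hx) (mem_univ _) (mem_univ _)
      (apply_mem_backwardReach_succ_iff hinj hx) hfail
    simp only [evenPart, mem_union, mem_inter_iff, mem_compl_iff, hB, hxB, false_and, false_or,
      not_false_eq_true, true_and, mem_iUnion (s := fun n => _ \ _), mem_sdiff]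
    exact key

end

/-- Every Borel partial injection on a standard Borel space is contained in the union of
two Borel bijections. -/
theorem stmt_5 {X : Type*} [MeasurableSpace X] [StandardBorelSpace X]
    (A : Set X) (hA : MeasurableSet A) (f : X → X) (hf : Measurable f)
    (hinj : Set.InjOn f A) :
    ∃ g h : X ≃ X, Measurable ⇑g ∧ Measurable ⇑g.symm ∧
      Measurable ⇑h ∧ Measurable ⇑h.symm ∧
      ∀ x ∈ A, f x = g x ∨ f x = h x := by
  have hBm := measurableSet_backwardReach hA hf hinj
  have hFm := measurableSet_forwardReach hA hf
  have hCm : MeasurableSet (twoSidedPart f A) :=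
    (MeasurableSet.iInter hBm).inter (MeasurableSet.iInter hFm)
  have hPm : MeasurableSet (evenPart f A) :=
    ((MeasurableSet.iInter hBm).inter (MeasurableSet.iUnion fun n => (hFm _).diff (hFm _))).union
      ((MeasurableSet.iInter hBm).compl.inter
        (MeasurableSet.iUnion fun n => (hBm _).diff (hBm _)))
  have extend (P : Set X) (hP : MeasurableSet P)
      (hflip : ∀ x ∈ A, x ∉ twoSidedPart f A → x ∈ P → f x ∉ P) :
      ∃ e : X ≃ X, Measurable e ∧ Measurable e.symm ∧
        ∀ x ∈ twoSidedPart f A ∪ ((A ∩ P) \ twoSidedPart f A), e x = f x :=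
    exists_measurable_equiv_extending_union hf hCm ((hA.inter hP).diff hCm)
      (bijOn_twoSidedPart hinj) (hinj.mono fun x hx => hx.1.1)
      (fun x hx hfx => hflip x hx.1.1 hx.2 hx.1.2 hfx.1.2) (fun x hx => hx.2)
      fun x hx => mt (apply_mem_twoSidedPart_iff hinj hx.1.1).1 hx.2
  obtain ⟨g, hg, hg', hgf⟩ := extend (evenPart f A) hPm fun x hx hxC hxP hfx =>
    (apply_mem_evenPart_iff hinj hx hxC).1 hfx hxP
  obtain ⟨h, hh, hh', hhf⟩ := extend (evenPart f A)ᶜ hPm.compl fun x hx hxC hxP hfx =>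
    hfx ((apply_mem_evenPart_iff hinj hx hxC).2 hxP)
  refine ⟨g, h, hg, hg', hh, hh', fun x hx => ?_⟩
  by_cases hxC : x ∈ twoSidedPart f A
  · exact .inl (hgf x (.inl hxC)).symm
  by_cases hxP : x ∈ evenPart f A
  · exact .inl (hgf x (.inr ⟨⟨hx, hxP⟩, hxC⟩)).symm
  · exact .inr (hhf x (.inr ⟨⟨hx, hxP⟩, hxC⟩)).symm
end

section
/- Let M be a set, A ⊆ M, and f : A → M an injective function. Then there exist two bijections g, h : M → M such that for every x ∈ A, f x = g x or f x = h x. (Every injective partial function on a set is contained in the union of the graphs of two permutations.) -/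
/-- A function injective on `B` agrees on `B` with a permutation as soon as every point of `B` has
its image in `B` exactly when it is itself an image of a point of `B`. -/
theorem Set.InjOn.exists_perm_eqOn {M : Type*} {B : Set M} {f : M → M} (hinj : Set.InjOn f B)
    (hB : ∀ x ∈ B, f x ∈ B ↔ x ∈ f '' B) : ∃ g : Equiv.Perm M, Set.EqOn f g B := by
  classical
  rcases isEmpty_or_nonempty M with hM | hM
  · exact ⟨1, fun x => hM.elim x⟩
  let k := Function.invFunOn f B
  have hkf : ∀ x ∈ B, k (f x) = x := hinj.leftInvOn_invFunOn
  have him : ∀ x ∈ B, f x ∈ f '' B := fun x hx => Set.mem_image_of_mem f hx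
  have hk : ∀ x ∈ f '' B, k x ∈ B ∧ f (k x) = x := fun x hx =>
    ⟨Function.invFunOn_mem hx, Function.invFunOn_eq hx⟩
  refine ⟨⟨fun x => if x ∈ B then f x else if x ∈ f '' B then k x else x,
    fun x => if x ∈ f '' B then k x else if x ∈ B then f x else x, fun x => ?_, fun x => ?_⟩,
    fun x hx => (if_pos hx).symm⟩
  · generalize f '' B = I at *
    grind
  · generalize f '' B = I at *
    grind

/-- Some predicate alternates along the part in `S` of every orbit of `φ` that leaves `S`, namely
the parity of the number of steps before leaving. -/
theorem exists_alternating_of_escape {M : Type*} (φ : M → M) (S : Set M) :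
    ∃ c : M → Prop, ∀ x ∈ S, (∃ n, φ^[n] x ∉ S) → (c x ↔ ¬ c (φ x)) := by
  classical
  refine ⟨fun x => ∃ h : ∃ n, φ^[n] x ∉ S, Even (Nat.find h), fun x hx h => ?_⟩
  have h' : ∃ n, φ^[n + 1] x ∉ S := by
    obtain ⟨_ | n, hn⟩ := h
    · exact absurd hx hn
    · exact ⟨n, hn⟩
  have hs : ∃ n, φ^[n] (φ x) ∉ S := h'
  have key : Nat.find h = Nat.find hs + 1 := Nat.find_comp_succ h h' (by simpa using hx)
  simp only [h, hs, exists_true_left, key, Nat.even_add_one]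

/-- An orbit starting in `S` leaves `S` exactly when it does so from its second point on. -/
theorem escape_iff_escape_apply {M : Type*} {φ : M → M} {S : Set M} {x : M} (hx : x ∈ S) :
    (∃ n, φ^[n] x ∉ S) ↔ ∃ n, φ^[n] (φ x) ∉ S := by
  constructor
  · rintro ⟨_ | n, hn⟩
    · exact absurd hx hn
    · exact ⟨n, hn⟩
  · rintro ⟨n, hn⟩
    exact ⟨n + 1, hn⟩

/-- Every injective partial function on a set is contained in the union of the graphs of
two permutations. -/
theorem stmt_6 {M : Type*} (A : Set M) (f : M → M) (hinj : Set.InjOn f A) :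
    ∃ g h : Equiv.Perm M, ∀ x ∈ A, f x = g x ∨ f x = h x := by
  classical
  rcases isEmpty_or_nonempty M with hM | hM
  · exact ⟨1, 1, fun x => hM.elim x⟩
  let k := Function.invFunOn f A
  have hkf : ∀ x ∈ A, k (f x) = x := hinj.leftInvOn_invFunOn
  have him : ∀ x ∈ A, f x ∈ f '' A := fun x hx => Set.mem_image_of_mem f hx
  let F : M → Prop := fun x => ∃ n, f^[n] x ∉ A
  let G : M → Prop := fun x => ∃ n, k^[n] x ∉ f '' A
  have hF : ∀ x ∈ A, (F x ↔ F (f x)) := fun x hx => escape_iff_escape_apply hx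
  have hG : ∀ x ∈ A, (G x ↔ G (f x)) := fun x hx => by
    have := escape_iff_escape_apply (φ := k) (him x hx)
    rw [hkf x hx] at this
    exact this.symm
  obtain ⟨c, hc⟩ := exists_alternating_of_escape f A
  obtain ⟨d, hd⟩ := exists_alternating_of_escape k (f '' A)
  have hc' : ∀ x ∈ A, F x → (c x ↔ ¬ c (f x)) := hc
  have hd' : ∀ x ∈ A, G x → (d x ↔ ¬ d (f x)) := fun x hx h => by
    have := hd (f x) (him x hx) ((hG x hx).1 h)
    rw [hkf x hx] at this
    tauto
  have hFA : ∀ x, ¬ F x → x ∈ A := fun x h => by_contra fun hx => h ⟨0, hx⟩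
  have hGA : ∀ x, ¬ G x → ∃ y ∈ A, f y = x := fun x h => by_contra fun hx => h ⟨0, hx⟩
  let e : M → Prop := fun x => if F x then c x else d x
  have he : ∀ x ∈ A, F x ∨ G x → (e x ↔ ¬ e (f x)) := fun x hx h => by
    have hFx := hF x hx
    by_cases hx' : F x
    · simpa only [e, hx', hFx.1 hx', if_true] using hc' x hx hx'
    · simpa only [e, hx', mt hFx.2 hx', if_false] using hd' x hx (h.resolve_left hx')
  have main : ∀ p : M → Prop, (∀ x ∈ A, F x ∨ G x → (p x ↔ ¬ p (f x))) →
      ∃ g : Equiv.Perm M, Set.EqOn f g {x ∈ A | F x ∨ G x → p x} := fun p hp => by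
    refine (hinj.mono fun x hx => hx.1).exists_perm_eqOn fun x hx => ?_
    have hE : ∀ y ∈ A, (F y ∨ G y ↔ F (f y) ∨ G (f y)) := fun y hy =>
      or_congr (hF y hy) (hG y hy)
    by_cases hx' : F x ∨ G x
    · refine iff_of_false (fun h => ?_) ?_
      · exact (hp x hx.1 hx').1 (hx.2 hx') (h.2 ((hE x hx.1).1 hx'))
      · rintro ⟨y, hy, rfl⟩
        have hy' := (hE y hy.1).2 hx'
        exact (hp y hy.1 hy').1 (hy.2 hy') (hx.2 hx')
    · have hfx := mt (hE x hx.1).2 hx'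
      refine iff_of_true ⟨hFA _ fun h => hfx (.inl h), fun h => absurd h hfx⟩ ?_
      obtain ⟨y, hy, rfl⟩ := hGA x fun h => hx' (.inr h)
      exact ⟨y, ⟨hy, fun h => absurd ((hE y hy).1 h) hx'⟩, rfl⟩
  -- Points whose orbit never ends in either direction belong to both pieces.
  obtain ⟨g, hg⟩ := main e he
  obtain ⟨h, hh⟩ := main (fun x => ¬ e x) fun x hx hx' => not_congr (he x hx hx')
  refine ⟨g, h, fun x hx => ?_⟩
  by_cases hex : e x
  · exact .inl (hg ⟨hx, fun _ => hex⟩)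
  · exact .inr (hh ⟨hx, fun _ => hex⟩)
end

section
/- For any set M, the following are equivalent: (i) there exists a sequence (g_i : M → M)_{i ∈ ℕ} of involutions (g_i ∘ g_i = id) such that for all x, y ∈ M there is i with g_i x = y; (ii) there exists a proper edge ℕ-coloring of the complete graph on M. Concretely, from (i) one obtains (ii) by setting c x y := the least i with g_i x = y, and from (ii) one obtains (i) by taking, for each color k, the involution swapping x with the unique y such that c x y = k (when it exists, fixing x otherwise), together with the identity. -/
open Classical in
/-- The map sending `x` to its neighbour along an edge of color `k`, if there is one, and to
itself otherwise. -/
noncomputable def colorSwap {M : Type*} (c : M → M → ℕ) (k : ℕ) (x : M) : M :=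
  if h : ∃ y, x ≠ y ∧ c x y = k then h.choose else x

theorem colorSwap_eq {M : Type*} {c : M → M → ℕ}
    (hc : ∀ x y z : M, x ≠ y → x ≠ z → c x y = c x z → y = z) {x y : M} (hxy : x ≠ y) :
    colorSwap c (c x y) x = y := by
  have h : ∃ z, x ≠ z ∧ c x z = c x y := ⟨y, hxy, rfl⟩
  rw [colorSwap, dif_pos h]
  exact hc x _ _ h.choose_spec.1 hxy h.choose_spec.2

theorem colorSwap_involutive {M : Type*} {c : M → M → ℕ}
    (hsymm : ∀ x y : M, x ≠ y → c x y = c y x)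
    (hc : ∀ x y z : M, x ≠ y → x ≠ z → c x y = c x z → y = z) (k : ℕ) :
    Function.Involutive (colorSwap c k) := by
  intro x
  by_cases h : ∃ y, x ≠ y ∧ c x y = k
  · obtain ⟨y, hxy, rfl⟩ := h
    rw [colorSwap_eq hc hxy, hsymm x y hxy, colorSwap_eq hc hxy.symm]
  · have hx : colorSwap c k x = x := dif_neg h
    rw [hx, hx]

/-- For any set `M`, the existence of a covering family of involutions is equivalent to the
existence of a proper edge `ℕ`-coloring of the complete graph on `M`. -/
theorem stmt_7 {M : Type*} :
    (∃ g : ℕ → M → M, (∀ i, g i ∘ g i = id) ∧ ∀ x y : M, ∃ i, g i x = y) ↔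
    (∃ c : M → M → ℕ,
      (∀ x y : M, x ≠ y → c x y = c y x) ∧
      (∀ x y x' y' : M, x ≠ y → x' ≠ y' → ({x, y} : Set M) ≠ {x', y'} →
        (({x, y} : Set M) ∩ {x', y'}).Nonempty → c x y ≠ c x' y')) := by
  classical
  constructor
  · rintro ⟨g, hg, hcover⟩
    have hinv : ∀ i x, g i (g i x) = x := fun i x => congrFun (hg i) x
    have hswap : ∀ {i x y}, g i x = y → g i y = x := by
      rintro i x _ rfl
      exact hinv i x
    refine ⟨fun x y => Nat.find (hcover x y), fun x y _ => ?_, ?_⟩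
    · exact Nat.find_congr' ⟨hswap, hswap⟩
    · intro x y x' y' _ _ hne hmeet heq
      dsimp only at heq
      have h := Nat.find_spec (hcover x y)
      have h' := Nat.find_spec (hcover x' y')
      rw [← heq] at h'
      generalize Nat.find (hcover x y) = i at h h'
      have pair_eq : ∀ {a b z}, g i a = b → z ∈ ({a, b} : Set M) →
          ({a, b} : Set M) = {z, g i z} := by
        rintro a b z rfl (rfl | rfl)
        · rfl
        · rw [hinv, Set.pair_comm]
      obtain ⟨z, hz, hz'⟩ := hmeet
      exact hne ((pair_eq h hz).trans (pair_eq h' hz').symm)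
  · rintro ⟨c, hsymm, hproper⟩
    have hc : ∀ x y z : M, x ≠ y → x ≠ z → c x y = c x z → y = z := by
      intro x y z hxy hxz heq
      by_contra hyz
      refine hproper x y x z hxy hxz (fun hset => ?_) ⟨x, by simp⟩ heq
      have hy : y ∈ ({x, z} : Set M) := hset ▸ Set.mem_insert_of_mem x rfl
      exact hy.elim (fun h => hxy h.symm) hyz
    refine ⟨fun n => Nat.casesOn n id (colorSwap c), fun i => ?_, fun x y => ?_⟩
    · cases i with
      | zero => rfl
      | succ k => exact (colorSwap_involutive hsymm hc k).comp_self
    · by_cases hxy : x = y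
      · exact ⟨0, hxy⟩
      · exact ⟨c x y + 1, colorSwap_eq hc hxy⟩
end

section
/- Let Y be a linearly ordered set and c : Y → Y → ℕ a proper edge ℕ-coloring of the complete graph on Y. Let S and T be finite subsets of Y with the same cardinality n ≥ 1 and with S ∩ T ≠ ∅, and let s_0 < s_1 < ⋯ < s_{n−1} and t_0 < t_1 < ⋯ < t_{n−1} be the increasing enumerations of S and T. If c(s_i, s_j) = c(t_i, t_j) for all i ≠ j < n, then S = T. Consequently, assigning to each finite subset S of cardinality n the data (n, (c(s_i, s_j))_{i<j<n}) yields a coloring of the finite subsets of Y under which any two distinct intersecting finite subsets receive different values. -/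
/-- In a proper edge coloring, the edges at a vertex are determined by their colors. -/
theorem eq_of_edgeColor_eq {Y C : Type*} {c : Y → Y → C}
    (hproper : ∀ x y x' y' : Y, x ≠ y → x' ≠ y' → ({x, y} : Set Y) ≠ {x', y'} →
      (({x, y} : Set Y) ∩ {x', y'}).Nonempty → c x y ≠ c x' y')
    {x y z : Y} (hy : x ≠ y) (hz : x ≠ z) (h : c x y = c x z) : y = z := by
  by_contra hyz
  refine hproper x y x z hy hz (fun hset => ?_) ⟨x, by simp⟩ h
  have hmem : y ∈ ({x, z} : Set Y) := hset ▸ (by simp)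
  rcases hmem with h' | h'
  · exact hy h'.symm
  · exact hyz h'

/-- Two strictly increasing families with the same edge-color pattern and a common value
are equal. -/
theorem StrictMono.eq_of_edgeColor_eq {ι Y C : Type*} [LinearOrder ι] [LinearOrder Y]
    {c : Y → Y → C} (hsymm : ∀ x y : Y, x ≠ y → c x y = c y x)
    (hproper : ∀ x y x' y' : Y, x ≠ y → x' ≠ y' → ({x, y} : Set Y) ≠ {x', y'} →
      (({x, y} : Set Y) ∩ {x', y'}).Nonempty → c x y ≠ c x' y')
    {s t : ι → Y} (hs : StrictMono s) (ht : StrictMono t)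
    (hc : ∀ i j, i ≠ j → c (s i) (s j) = c (t i) (t j))
    {i j : ι} (hij : s i = t j) : s = t := by
  obtain rfl : i = j := by
    by_contra hne
    have hti : t j ≠ t i := fun h => hne (ht.injective h).symm
    have hsj : t j ≠ s j := hij ▸ hs.injective.ne hne
    have hcol : c (t j) (s j) = c (t j) (t i) := by
      rw [hsymm _ _ hti, ← hc i j hne, hij]
    have heq := _root_.eq_of_edgeColor_eq hproper hsj hti hcol
    rcases lt_or_gt_of_ne hne with hlt | hlt
    · exact lt_asymm (hij ▸ hs hlt) (heq ▸ ht hlt)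
    · exact lt_asymm (hij ▸ hs hlt) (heq ▸ ht hlt)
  funext k
  by_cases hk : i = k
  · exact hk ▸ hij
  · refine _root_.eq_of_edgeColor_eq hproper (hs.injective.ne hk) ?_ ((hc i k hk).trans ?_)
    · exact hij ▸ ht.injective.ne hk
    · rw [hij]

/-- **Kechris–Miller construction**: given a linear order and a proper edge `ℕ`-coloring of
the complete graph, two intersecting finite subsets of the same cardinality `n ≥ 1` whose
increasing enumerations induce the same pattern of edge colors must be equal. -/
theorem stmt_8 {Y : Type*} [LinearOrder Y] (c : Y → Y → ℕ)
    (hsymm : ∀ x y : Y, x ≠ y → c x y = c y x)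
    (hproper : ∀ x y x' y' : Y, x ≠ y → x' ≠ y' → ({x, y} : Set Y) ≠ {x', y'} →
      (({x, y} : Set Y) ∩ {x', y'}).Nonempty → c x y ≠ c x' y')
    (n : ℕ) (hn : 1 ≤ n) (S T : Finset Y) (hS : S.card = n) (hT : T.card = n)
    (hST : (S ∩ T).Nonempty)
    (hc : ∀ i j : Fin n, i ≠ j →
      c ↑(S.orderIsoOfFin hS i) ↑(S.orderIsoOfFin hS j) =
        c ↑(T.orderIsoOfFin hT i) ↑(T.orderIsoOfFin hT j)) :
    S = T := by
  obtain ⟨x, hx⟩ := hST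
  rw [Finset.mem_inter] at hx
  have hxS : x ∈ Set.range (S.orderEmbOfFin hS) := by simpa using hx.1
  have hxT : x ∈ Set.range (T.orderEmbOfFin hT) := by simpa using hx.2
  obtain ⟨i, hi⟩ := hxS
  obtain ⟨j, hj⟩ := hxT
  have heq := StrictMono.eq_of_edgeColor_eq hsymm hproper (S.orderEmbOfFin hS).strictMono
    (T.orderEmbOfFin hT).strictMono hc (hi.trans hj.symm)
  rw [← Finset.coe_inj, ← Finset.range_orderEmbOfFin S hS, ← Finset.range_orderEmbOfFin T hT, heq]
end

section
/- Let X be a standard Borel space and E a countable Borel equivalence relation on X. Then there exists a function D : Finset X → ℕ such that: (a) for every n ∈ ℕ, the map (Fin n → X) → ℕ sending a tuple v to D of the image of v is Borel (with respect to the product measurable structure on Fin n → X); and (b) whenever S ≠ T are nonempty finite subsets of X, each contained in a single E-class, and S ∩ T ≠ ∅, then D S ≠ D T. (Kechris–Miller: every CBER admits a Borel ℕ-coloring of the intersection graph on finite subsets of its classes.) -/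
open MeasureTheory Set Function Filter Topology

section LusinNovikov

variable {X Y : Type*} [MeasurableSpace X] [MeasurableSpace Y]

/-- `A` is contained in a countable union of measurable graphs of partial functions. -/
def GraphCovered (A : Set (X × Y)) : Prop :=
  ∃ F : ℕ → Set (X × Y), (∀ n, MeasurableSet (F n) ∧ InjOn Prod.fst (F n)) ∧ A ⊆ ⋃ n, F n

lemma GraphCovered.of_injOn {A : Set (X × Y)} (hA : MeasurableSet A) (h : InjOn Prod.fst A) :
    GraphCovered A :=
  ⟨fun _ => A, fun _ => ⟨hA, h⟩, fun _ hp => mem_iUnion.2 ⟨0, hp⟩⟩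

lemma GraphCovered.iUnion {ι : Type*} [Countable ι] {A : ι → Set (X × Y)}
    (h : ∀ i, GraphCovered (A i)) : GraphCovered (⋃ i, A i) := by
  choose F hF hAF using h
  rcases isEmpty_or_nonempty ι with _ | _
  · exact ⟨fun _ => ∅, fun _ => ⟨.empty, by simp⟩, by simp⟩
  obtain ⟨e, he⟩ := exists_surjective_nat (ι × ℕ)
  refine ⟨fun n => F (e n).1 (e n).2, fun n => hF _ _, iUnion_subset fun i p hp => ?_⟩
  obtain ⟨n, hn⟩ := mem_iUnion.1 (hAF i hp)
  obtain ⟨m, hm⟩ := he (i, n)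
  exact mem_iUnion.2 ⟨m, by simpa [hm] using hn⟩

lemma GraphCovered.union {A B : Set (X × Y)} (hA : GraphCovered A) (hB : GraphCovered B) :
    GraphCovered (A ∪ B) := by
  rw [union_eq_iUnion]
  exact .iUnion fun b => by cases b <;> assumption

/-- An analytic graph of a partial function extends to a measurable one. -/
lemma exists_measurable_graph_of_injOn [TopologicalSpace X] [PolishSpace X] [BorelSpace X]
    {Z : Type*} [MeasurableSpace Z] [StandardBorelSpace Z] {s : Set Z} (hs : MeasurableSet s)
    {g : Z → X × (ℕ → Bool)} (hg : Measurable g) (hinj : InjOn Prod.fst (g '' s)) :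
    ∃ H, MeasurableSet H ∧ InjOn Prod.fst H ∧ g '' s ⊆ H := by
  have hbit (k : ℕ) (b : Bool) : MeasurableSet {z | (g z).2 k = b} :=
    ((measurable_pi_apply k).comp hg.snd) (measurableSet_singleton b)
  have han (k : ℕ) (b : Bool) :
      AnalyticSet ((fun z => (g z).1) '' (s ∩ {z | (g z).2 k = b})) :=
    (hs.inter (hbit k b)).analyticSet_image hg.fst
  have hsep (k : ℕ) : ∃ U : Set X, MeasurableSet U ∧ ∀ z ∈ s, (g z).1 ∈ U ↔ (g z).2 k = true := by
    have hd : Disjoint ((fun z => (g z).1) '' (s ∩ {z | (g z).2 k = true}))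
        ((fun z => (g z).1) '' (s ∩ {z | (g z).2 k = false})) := by
      rw [disjoint_left]
      rintro _ ⟨z, ⟨hz, hzk⟩, rfl⟩ ⟨w, ⟨hw, hwk⟩, hzw⟩
      have := hinj (mem_image_of_mem g hw) (mem_image_of_mem g hz) hzw
      simp_all
    obtain ⟨U, hU, hU', hUm⟩ := (han k true).measurablySeparable (han k false) hd
    refine ⟨U, hUm, fun z hz => ⟨fun h => ?_, fun h => hU ⟨z, ⟨hz, h⟩, rfl⟩⟩⟩
    by_contra hne
    exact disjoint_left.1 hU' ⟨z, ⟨hz, by simpa using hne⟩, rfl⟩ h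
  choose U hUm hU using hsep
  refine ⟨{p | ∀ k, p.1 ∈ U k ↔ p.2 k = true}, ?_, ?_, ?_⟩
  · simp only [ofPred_forall]
    refine MeasurableSet.iInter fun k => ?_
    have hm : Measurable fun p : X × (ℕ → Bool) => p.2 k :=
      (measurable_pi_apply k).comp measurable_snd
    have hk : MeasurableSet {p : X × (ℕ → Bool) | p.2 k = true} := hm (measurableSet_singleton true)
    exact (measurable_fst (hUm k)).iff hk
  · rintro ⟨x, y⟩ hy ⟨x', y'⟩ hy' (rfl : x = x')
    refine Prod.ext rfl (funext fun k => ?_)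
    exact Bool.eq_iff_iff.2 ((hy k).symm.trans (hy' k))
  · rintro _ ⟨z, hz, rfl⟩ k
    exact hU k z hz

/-- Sequences of points of the boxes `V j` with a common first coordinate under `f` can be found
avoiding every measurable set covered by countably many graphs. -/
def IsLargeBox {Z : Type*} (f : Z → X × Y) (V : ℕ → Set Z) : Prop :=
  ∀ W, MeasurableSet W → GraphCovered W →
    ∃ γ : ℕ → Z, (∀ j, γ j ∈ V j) ∧ (∀ j, (f (γ j)).1 = (f (γ 0)).1) ∧ ∀ j, f (γ j) ∉ W

lemma IsLargeBox.exists_update_inter {Z ι : Type*} [Countable ι] {f : Z → X × Y} {V : ℕ → Set Z}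
    (h : IsLargeBox f V) (i : ℕ) {c : ι → Set Z} (hc : ∀ z, ∃ k, z ∈ c k) :
    ∃ k, IsLargeBox f (update V i (V i ∩ c k)) := by
  by_contra! hbad
  simp only [IsLargeBox, not_forall] at hbad
  choose W hWm hWc hW using hbad
  obtain ⟨γ, hγV, hγ1, hγW⟩ := h (⋃ k, W k) (.iUnion hWm) (.iUnion hWc)
  obtain ⟨k, hk⟩ := hc (γ i)
  refine hW k ⟨γ, fun j => ?_, hγ1, fun j hj => hγW j (mem_iUnion.2 ⟨k, hj⟩)⟩
  rcases eq_or_ne j i with rfl | hj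
  · simpa using ⟨hγV j, hk⟩
  · simpa [hj] using hγV j

variable [TopologicalSpace X] [PolishSpace X] [BorelSpace X]

lemma IsLargeBox.exists_split {Z : Type*} [MeasurableSpace Z] [StandardBorelSpace Z]
    {f : Z → X × (ℕ → Bool)} (hf : Measurable f) {V : ℕ → Set Z} (h : IsLargeBox f V)
    (hV : ∀ j, MeasurableSet (V j)) {i m : ℕ} (him : i ≠ m) (hm : V m = univ) :
    ∃ k, IsLargeBox f (update (update V i (V i ∩ {z | (f z).2 k = false})) m
      (V i ∩ {z | (f z).2 k = true})) := by
  by_contra! hbad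
  simp only [IsLargeBox, not_forall] at hbad
  choose W hWm hWc hW using hbad
  set W' := ⋃ k, W k with hW'
  have hW'm : MeasurableSet W' := .iUnion hWm
  set s : Set (ℕ → Z) := {γ | (∀ j, γ j ∈ V j) ∧ (∀ j, (f (γ j)).1 = (f (γ 0)).1) ∧
    ∀ j, f (γ j) ∉ W'} with hs
  have hfm (j : ℕ) : Measurable fun γ : ℕ → Z => f (γ j) := hf.comp (measurable_pi_apply j)
  have hsm : MeasurableSet s := by
    have h1 : MeasurableSet {γ : ℕ → Z | ∀ j, γ j ∈ V j} := by
      simp only [ofPred_forall]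
      exact .iInter fun j => measurable_pi_apply j (hV j)
    have h2 : MeasurableSet {γ : ℕ → Z | ∀ j, (f (γ j)).1 = (f (γ 0)).1} := by
      simp only [ofPred_forall]
      exact .iInter fun j => measurableSet_eq_fun (hfm j).fst (hfm 0).fst
    have h3 : MeasurableSet {γ : ℕ → Z | ∀ j, f (γ j) ∉ W'} := by
      simp only [ofPred_forall]
      exact .iInter fun j => hfm j hW'm.compl
    exact h1.inter (h2.inter h3)
  have key : ∀ γ ∈ s, ∀ δ ∈ s, (f (γ i)).1 = (f (δ i)).1 → ∀ k, (f (γ i)).2 k = false →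
      (f (δ i)).2 k = true → False := by
    rintro γ ⟨hγV, hγ1, hγW⟩ δ ⟨hδV, hδ1, hδW⟩ h1 k hγk hδk
    have hfst (j : ℕ) : (f (update γ m (δ i) j)).1 = (f (γ 0)).1 := by
      rcases eq_or_ne j m with rfl | hj
      · simpa using h1.symm.trans (hγ1 i)
      · simpa [hj] using hγ1 j
    refine hW k ⟨update γ m (δ i), fun j => ?_, fun j => (hfst j).trans (hfst 0).symm,
      fun j hj => ?_⟩
    · rcases eq_or_ne j m with rfl | hjm
      · simpa using ⟨hδV i, hδk⟩
      · rcases eq_or_ne j i with rfl | hji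
        · simpa [hjm] using ⟨hγV j, hγk⟩
        · simpa [hjm, hji] using hγV j
    · have hj' : f (update γ m (δ i) j) ∈ W' := mem_iUnion.2 ⟨k, hj⟩
      rcases eq_or_ne j m with rfl | hjm
      · exact hδW i (by rwa [update_self] at hj')
      · exact hγW j (by rwa [update_of_ne hjm] at hj')
  have hinj : InjOn Prod.fst ((fun γ : ℕ → Z => f (γ i)) '' s) := by
    rintro _ ⟨γ, hγ, rfl⟩ _ ⟨δ, hδ, rfl⟩ h1
    refine Prod.ext h1 (funext fun k => ?_)
    cases hγk : (f (γ i)).2 k <;> cases hδk : (f (δ i)).2 k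
    · rfl
    · exact (key γ hγ δ hδ h1 k hγk hδk).elim
    · exact (key δ hδ γ hγ h1.symm k hδk hγk).elim
    · rfl
  obtain ⟨H, hHm, hHi, hH⟩ := exists_measurable_graph_of_injOn hsm (hfm i) hinj
  obtain ⟨γ, hγV, hγ1, hγW⟩ := h (W' ∪ H) (hW'm.union hHm)
    ((GraphCovered.iUnion hWc).union (.of_injOn hHm hHi))
  exact hγW i (.inr (hH ⟨γ, ⟨hγV, hγ1, fun j hj => hγW j (.inl hj)⟩, rfl⟩))

lemma IsLargeBox.exists_step {f : (ℕ → ℕ) → X × (ℕ → Bool)} (hf : Continuous f)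
    {V : ℕ → Set (ℕ → ℕ)} (h : IsLargeBox f V) (hV : ∀ j, IsClosed (V j)) {i m : ℕ} (him : i < m)
    (hm : ∀ j, m ≤ j → V j = univ) (n : ℕ) :
    ∃ V' : ℕ → Set (ℕ → ℕ), IsLargeBox f V' ∧ (∀ j, IsClosed (V' j)) ∧
      (∀ j, m + 1 ≤ j → V' j = univ) ∧ (∀ j, V' j ⊆ V j) ∧ V' m ⊆ V i ∧
      (∀ z ∈ V' i, ∀ w ∈ V' m, (f z).2 ≠ (f w).2) ∧
      ∀ z ∈ V' i, ∀ w ∈ V' i, ∀ l < n, z l = w l := by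
  obtain ⟨c, hc⟩ := h.exists_update_inter i (c := fun c : Fin n → ℕ => {z | ∀ l : Fin n, z l = c l})
    fun z => ⟨fun l => z l, fun _ => rfl⟩
  set A := V i ∩ {z | ∀ l : Fin n, z l = c l} with hA
  have hAcl : IsClosed A := by
    refine (hV i).inter ?_
    simp only [ofPred_forall]
    exact isClosed_iInter fun l => isClosed_eq (continuous_apply _) continuous_const
  have hcl (j : ℕ) : IsClosed (update V i A j) := by
    rcases eq_or_ne j i with rfl | hj
    · simpa using hAcl
    · simpa [hj] using hV j
  obtain ⟨k, hk⟩ := hc.exists_split hf.measurable (fun j => (hcl j).measurableSet) him.ne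
    (by simpa [him.ne'] using hm m le_rfl)
  have hbit (b : Bool) : IsClosed {z | (f z).2 k = b} :=
    isClosed_eq ((continuous_apply k).comp (continuous_snd.comp hf)) continuous_const
  simp only [update_self, update_idem] at hk
  refine ⟨_, hk, fun j => ?_, fun j hj => ?_, fun j => ?_, ?_, ?_, ?_⟩
  · rcases eq_or_ne j m with rfl | hjm
    · simpa using hAcl.inter (hbit true)
    · rcases eq_or_ne j i with rfl | hji
      · simpa [hjm] using hAcl.inter (hbit false)
      · simpa [hjm, hji] using hV j
  · have h1 : j ≠ m := by omega
    have h2 : j ≠ i := by omega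
    simpa [h1, h2] using hm j (by omega)
  · rcases eq_or_ne j m with rfl | hjm
    · simp [hm j le_rfl]
    · rcases eq_or_ne j i with rfl | hji
      · simp only [update_of_ne hjm, update_self]
        exact inter_subset_left.trans inter_subset_left
      · simp [hjm, hji]
  · simp only [update_self]
    exact inter_subset_left.trans inter_subset_left
  · simp only [update_of_ne him.ne, update_self]
    rintro z ⟨-, hz⟩ w ⟨-, hw⟩ hzw
    simp only [mem_ofPred_eq] at hz hw
    simp [hzw, hw] at hz
  · simp only [update_of_ne him.ne, update_self]
    rintro z ⟨⟨-, hz⟩, -⟩ w ⟨⟨-, hw⟩, -⟩ l hl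
    exact (hz ⟨l, hl⟩).trans (hw ⟨l, hl⟩).symm

/-- A continuous parametrization of a set that is not covered by countably many measurable graphs
has an uncountable vertical section. -/
lemma graphCovered_range {f : (ℕ → ℕ) → X × (ℕ → Bool)} (hf : Continuous f)
    (hcount : ∀ x, {y | (x, y) ∈ range f}.Countable) : GraphCovered (range f) := by
  by_contra hcov
  have h0 : IsLargeBox f fun _ => univ := by
    rintro W - hW
    have : ∃ z, f z ∉ W := by
      by_contra! hall
      obtain ⟨F, hF, hWF⟩ := hW
      exact hcov ⟨F, hF, (range_subset_iff.2 hall).trans hWF⟩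
    obtain ⟨z, hz⟩ := this
    exact ⟨fun _ => z, by simp, by simp, fun _ => hz⟩
  let S (n : ℕ) := {V : ℕ → Set (ℕ → ℕ) //
    IsLargeBox f V ∧ (∀ j, IsClosed (V j)) ∧ ∀ j, n + 1 ≤ j → V j = univ}
  have step (n : ℕ) (V : S n) : ∃ V' : S (n + 1), (∀ j, V'.1 j ⊆ V.1 j) ∧
      V'.1 (n + 1) ⊆ V.1 n.unpair.1 ∧
      (∀ z ∈ V'.1 n.unpair.1, ∀ w ∈ V'.1 (n + 1), (f z).2 ≠ (f w).2) ∧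
      ∀ z ∈ V'.1 n.unpair.1, ∀ w ∈ V'.1 n.unpair.1, ∀ l < n, z l = w l := by
    obtain ⟨V', h1, h2, h3, h4⟩ := V.2.1.exists_step hf V.2.2.1
      (Nat.lt_succ_of_le (Nat.unpair_left_le n)) V.2.2.2 n
    exact ⟨⟨V', h1, h2, h3⟩, h4⟩
  choose next hsub hfresh hne hdiam using step
  let T (n : ℕ) : S n := Nat.rec ⟨fun _ => univ, h0, fun _ => isClosed_univ, fun _ _ => rfl⟩ next n
  let V (n : ℕ) : ℕ → Set (ℕ → ℕ) := (T n).1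
  have hanti (j : ℕ) : Antitone fun n => V n j := antitone_nat_of_succ_le fun n => hsub n (T n) j
  have hcl (n j : ℕ) : IsClosed (V n j) := (T n).2.2.1 j
  have hcfg (n : ℕ) : ∃ γ : ℕ → ℕ → ℕ, (∀ j, γ j ∈ V n j) ∧ ∀ j, (f (γ j)).1 = (f (γ 0)).1 := by
    obtain ⟨γ, h1, h2, -⟩ := (T n).2.1 ∅ .empty (.of_injOn .empty (by simp))
    exact ⟨γ, h1, h2⟩
  choose γ hγV hγ1 using hcfg
  have hagree (j l : ℕ) : ∀ z ∈ V (Nat.pair j (l + 1) + 1) j,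
      ∀ w ∈ V (Nat.pair j (l + 1) + 1) j, ∀ r ≤ l, z r = w r := by
    intro z hz w hw r hr
    have := hdiam (Nat.pair j (l + 1)) (T _)
    simp only [Nat.unpair_pair] at this
    exact this z hz w hw r ((Nat.lt_succ_of_le hr).trans_le (Nat.right_le_pair _ _))
  let g (j l : ℕ) : ℕ := γ (Nat.pair j (l + 1) + 1) j l
  have hlim (j : ℕ) : Tendsto (fun n => γ n j) atTop (𝓝 (g j)) := by
    refine tendsto_pi_nhds.2 fun l => tendsto_const_nhds.congr' ?_
    filter_upwards [eventually_ge_atTop (Nat.pair j (l + 1) + 1)] with n hn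
    exact hagree j l _ (hγV (Nat.pair j (l + 1) + 1) j) _ (hanti j hn (hγV n j)) l le_rfl
  have hgV (n j : ℕ) : g j ∈ V n j :=
    (hcl n j).mem_of_tendsto (hlim j) <| by
      filter_upwards [eventually_ge_atTop n] with k hk using hanti j hk (hγV k j)
  have hg1 (j : ℕ) : (f (g j)).1 = (f (g 0)).1 := by
    have hc (j : ℕ) := ((continuous_fst.comp hf).tendsto (g j)).comp (hlim j)
    refine tendsto_nhds_unique (hc j) ((hc 0).congr fun n => ?_)
    exact (hγ1 n j).symm
  have hgne (n : ℕ) : (f (g n.unpair.1)).2 ≠ (f (g (n + 1))).2 :=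
    hne n (T n) _ (hgV (n + 1) _) _ (hgV (n + 1) _)
  set x := (f (g 0)).1 with hx
  let K : Set (ℕ → ℕ) := closure (range g)
  have hK : IsClosed K := isClosed_closure
  have hK1 : ∀ z ∈ K, (f z).1 = x := fun z hz =>
    closure_minimal (t := {z | (f z).1 = x}) (range_subset_iff.2 hg1)
      (isClosed_eq (continuous_fst.comp hf) continuous_const) hz
  have : PolishSpace K := hK.polishSpace
  have : Nonempty K := ⟨⟨g 0, subset_closure ⟨0, rfl⟩⟩⟩
  have : Countable {y | (x, y) ∈ range f} := (hcount x).to_subtype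
  obtain ⟨y, z, hz⟩ := nonempty_interior_of_iUnion_of_closed
    (f := fun y : {y | (x, y) ∈ range f} => {z : K | (f z).2 = y})
    (fun y => isClosed_eq (continuous_snd.comp (hf.comp continuous_subtype_val)) continuous_const)
    (eq_univ_of_forall fun z => mem_iUnion.2
      ⟨⟨(f z).2, z, Prod.ext (hK1 z z.2) rfl⟩, rfl⟩)
  obtain ⟨U, hU, hUeq⟩ := isOpen_induced_iff.1 (isOpen_interior (s := {z : K | (f z).2 = y}))
  have hUy (j : ℕ) (hj : g j ∈ U) : (f (g j)).2 = y :=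
    interior_subset (s := {z : K | (f z).2 = y})
      (hUeq ▸ hj : (⟨g j, subset_closure ⟨j, rfl⟩⟩ : K) ∈ interior {z : K | (f z).2 = y})
  have hzU : (z : ℕ → ℕ) ∈ U := by rw [← hUeq] at hz; exact hz
  obtain ⟨_, hjU, j, rfl⟩ := mem_closure_iff.1 z.2 U hU hzU
  have hnear : Tendsto (fun l => g (Nat.pair j (l + 1 + Nat.pair j (l + 1)) + 1)) atTop
      (𝓝 (g j)) := by
    refine tendsto_pi_nhds.2 fun r => tendsto_const_nhds.congr' ?_
    filter_upwards [eventually_ge_atTop r] with l hl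
    set N := Nat.pair j (l + 1 + Nat.pair j (l + 1)) with hN
    have hle : Nat.pair j (l + 1) + 1 ≤ N :=
      le_trans (by omega) (Nat.right_le_pair j (l + 1 + Nat.pair j (l + 1)))
    have hmem : g (N + 1) ∈ V N j := by
      have := hfresh N (T N)
      rw [hN, Nat.unpair_pair, ← hN] at this
      exact this (hgV (N + 1) (N + 1))
    exact hagree j l _ (hgV (Nat.pair j (l + 1) + 1) j) _ (hanti j hle hmem) r hl
  obtain ⟨l, hl⟩ := (hnear.eventually (hU.mem_nhds hjU)).exists
  have := hgne (Nat.pair j (l + 1 + Nat.pair j (l + 1)))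
  rw [Nat.unpair_pair] at this
  exact this ((hUy j hjU).trans (hUy _ hl).symm)

omit [TopologicalSpace X] [PolishSpace X] [BorelSpace X] in
/-- **Lusin–Novikov**: a measurable set with countable vertical sections is covered by countably
many measurable graphs of partial functions. -/
theorem MeasurableSet.graphCovered [StandardBorelSpace X] [StandardBorelSpace Y]
    {P : Set (X × Y)} (hP : MeasurableSet P) (hcount : ∀ x, {y | (x, y) ∈ P}.Countable) :
    GraphCovered P := by
  have : PolishSpace (ℕ → Bool) := ⟨⟩
  let φ := MeasurableSpace.mapNatBool X
  let ψ := MeasurableSpace.mapNatBool Y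
  have hφ : Injective φ := MeasurableSpace.injective_mapNatBool X
  have hψ : Injective ψ := MeasurableSpace.injective_mapNatBool Y
  have hm : Measurable (Prod.map φ ψ) :=
    (MeasurableSpace.measurable_mapNatBool X).prodMap (MeasurableSpace.measurable_mapNatBool Y)
  suffices h : GraphCovered (Prod.map φ ψ '' P) by
    obtain ⟨F, hF, hPF⟩ := h
    refine ⟨fun n => Prod.map φ ψ ⁻¹' F n, fun n => ⟨hm (hF n).1, ?_⟩, fun p hp => ?_⟩
    · intro p hp q hq hpq
      exact hφ.prodMap hψ ((hF n).2 hp hq (congrArg φ hpq))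
    · simpa using hPF (mem_image_of_mem _ hp)
  have han : AnalyticSet (Prod.map φ ψ '' P) := hP.analyticSet_image hm
  rw [AnalyticSet] at han
  rcases han with hempty | ⟨f, hf, hfP⟩
  · rw [hempty]
    exact .of_injOn .empty (by simp)
  · rw [← hfP]
    refine graphCovered_range hf fun a => ?_
    rw [hfP]
    by_cases ha : ∃ x, φ x = a
    · obtain ⟨x, rfl⟩ := ha
      refine ((hcount x).image ψ).mono ?_
      rintro y ⟨⟨x', y'⟩, hp, hxy⟩
      obtain ⟨h1, h2⟩ := Prod.mk.inj hxy
      obtain rfl := hφ h1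
      exact ⟨y', hp, h2⟩
    · convert countable_empty
      refine eq_empty_of_forall_notMem ?_
      rintro y ⟨⟨x', y'⟩, -, hxy⟩
      exact ha ⟨x', (Prod.mk.inj hxy).1⟩

end LusinNovikov

section Coloring

variable {X : Type*} [MeasurableSpace X]

/-- The data `(n, N, s, k)` describing an enumeration `w` of a finite set: the `i`-th point has
initial segment `s i` of length `N` under a coding map, and `(w i, w j)` lies in the graph with
index `k i j`. -/
abbrev EnumCode : Type := Σ n : ℕ, Σ N : ℕ, (Fin n → Fin N → Bool) × (Fin n → Fin n → ℕ)

/-- `c` describes the enumeration `w`, relative to the coding map `φ` and the graphs `F`. -/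
def EnumCode.Describes (φ : X → ℕ → Bool) (F : ℕ → Set (X × X)) (c : EnumCode)
    (w : Fin c.1 → X) : Prop :=
  Injective c.2.2.1 ∧ (∀ i, ∀ l : Fin c.2.1, φ (w i) l = c.2.2.1 i l) ∧
    ∀ i j, (w i, w j) ∈ F (c.2.2.2 i j)

lemma EnumCode.measurableSet_describes {φ : X → ℕ → Bool} (hφ : Measurable φ)
    {F : ℕ → Set (X × X)} (hF : ∀ n, MeasurableSet (F n)) (c : EnumCode) :
    MeasurableSet {w | c.Describes φ F w} := by
  have h1 : MeasurableSet {w : Fin c.1 → X | ∀ i, ∀ l : Fin c.2.1, φ (w i) l = c.2.2.1 i l} := by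
    simp only [ofPred_forall]
    refine .iInter fun i => .iInter fun l => ?_
    exact ((measurable_pi_apply _).comp (hφ.comp (measurable_pi_apply i)))
      (measurableSet_singleton (c.2.2.1 i l))
  have h2 : MeasurableSet {w : Fin c.1 → X | ∀ i j, (w i, w j) ∈ F (c.2.2.2 i j)} := by
    simp only [ofPred_forall]
    exact .iInter fun i => .iInter fun j =>
      ((measurable_pi_apply i).prodMk (measurable_pi_apply j)) (hF _)
  exact (MeasurableSet.const _).inter (h1.inter h2)

omit [MeasurableSpace X] in
lemma EnumCode.Describes.eq {φ : X → ℕ → Bool} {F : ℕ → Set (X × X)}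
    (hF : ∀ n, InjOn Prod.fst (F n)) {c : EnumCode} {w w' : Fin c.1 → X}
    (hw : c.Describes φ F w) (hw' : c.Describes φ F w') {i i' : Fin c.1} (h : w i = w' i') :
    w = w' := by
  obtain rfl : i = i' := hw.1 <| funext fun l => by rw [← hw.2.1, ← hw'.2.1, h]
  funext j
  exact congrArg Prod.snd (hF _ (hw.2.2 i j) (hw'.2.2 i j) h)

omit [MeasurableSpace X] in
lemma EnumCode.exists_describes {φ : X → ℕ → Bool} (hφ : Injective φ) {F : ℕ → Set (X × X)}
    {n : ℕ} {w : Fin n → X} (hw : Injective w) (hF : ∀ i j, (w i, w j) ∈ ⋃ k, F k) :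
    ∃ (N : ℕ) (s : Fin n → Fin N → Bool) (k : Fin n → Fin n → ℕ),
      EnumCode.Describes φ F ⟨n, N, s, k⟩ w := by
  choose k hk using fun i j => mem_iUnion.1 (hF i j)
  have hsep (i j : Fin n) : ∃ d, i ≠ j → φ (w i) d ≠ φ (w j) d := by
    by_cases hij : i = j
    · exact ⟨0, fun h => (h hij).elim⟩
    · obtain ⟨d, hd⟩ := Function.ne_iff.1 (hφ.ne (hw.ne hij))
      exact ⟨d, fun _ => hd⟩
  choose d hd using hsep
  let N := (Finset.univ.sup fun p : Fin n × Fin n => d p.1 p.2) + 1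
  refine ⟨N, fun i l => φ (w i) l, k, fun i j hij => ?_, fun _ _ => rfl, hk⟩
  by_contra hne
  have hle : d i j ≤ Finset.univ.sup fun p : Fin n × Fin n => d p.1 p.2 :=
    Finset.le_sup (f := fun p : Fin n × Fin n => d p.1 p.2) (Finset.mem_univ (i, j))
  exact hd i j hne (congrFun hij ⟨d i j, Nat.lt_succ_of_le hle⟩)

end Coloring

/-- **Kechris–Miller**: every countable Borel equivalence relation admits a Borel
`ℕ`-coloring of the intersection graph on finite subsets of its classes. -/
theorem stmt_9 {X : Type*} [MeasurableSpace X] [StandardBorelSpace X] [DecidableEq X]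
    (E : X → X → Prop) (hE : Equivalence E)
    (hBorel : MeasurableSet {p : X × X | E p.1 p.2})
    (hcount : ∀ x : X, {y : X | E x y}.Countable) :
    ∃ D : Finset X → ℕ,
      (∀ n : ℕ, Measurable (fun v : Fin n → X => D (Finset.univ.image v))) ∧
      (∀ S T : Finset X, S ≠ T → S.Nonempty → T.Nonempty →
        (∀ x ∈ S, ∀ y ∈ S, E x y) → (∀ x ∈ T, ∀ y ∈ T, E x y) →
        (S ∩ T).Nonempty → D S ≠ D T) := by
  classical
  obtain ⟨F, hF, hEF⟩ := hBorel.graphCovered hcount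
  let φ := MeasurableSpace.mapNatBool X
  have hφ : Injective φ := MeasurableSpace.injective_mapNatBool X
  have hφm : Measurable φ := MeasurableSpace.measurable_mapNatBool X
  have : Nonempty EnumCode := ⟨⟨0, 0, finZeroElim, finZeroElim⟩⟩
  obtain ⟨e, he⟩ := exists_surjective_nat EnumCode
  let Q (S : Finset X) (m : ℕ) : Prop :=
    ∃ w, (e m).Describes φ F w ∧ range w = S
  let Q' (S : Finset X) (m : ℕ) : Prop := Q S m ∨ ∀ m, ¬ Q S m
  have hQ' (S : Finset X) : ∃ m, Q' S m := by
    by_cases h : ∃ m, Q S m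
    · exact h.imp fun _ => .inl
    · exact ⟨0, .inr (not_exists.1 h)⟩
  refine ⟨fun S => Nat.find (hQ' S), fun n => ?_, fun S T hST _ _ hS hT hne hD => hST ?_⟩
  · have hQm (m : ℕ) : MeasurableSet {v : Fin n → X | Q (Finset.univ.image v) m} := by
      have heq : {v : Fin n → X | Q (Finset.univ.image v) m} =
          ⋃ σ : Fin (e m).1 → Fin n,
            {v | (e m).Describes φ F (v ∘ σ) ∧ ∀ j, ∃ i, v (σ i) = v j} := by
        ext v
        simp only [mem_ofPred_eq, mem_iUnion, Q, Finset.coe_image, Finset.coe_univ, image_univ]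
        constructor
        · rintro ⟨w, hw, hr⟩
          have (i : Fin (e m).1) : ∃ j, v j = w i := by
            rw [← mem_range, ← hr]
            exact mem_range_self i
          choose σ hσ using this
          obtain rfl : v ∘ σ = w := funext hσ
          refine ⟨σ, hw, fun j => ?_⟩
          have hj : v j ∈ range v := mem_range_self j
          rwa [← hr] at hj
        · rintro ⟨σ, hw, hr⟩
          refine ⟨_, hw, (range_comp_subset_range _ _).antisymm ?_⟩
          rintro _ ⟨j, rfl⟩
          exact hr j
      rw [heq]
      refine .iUnion fun σ => ?_
      have hcomp : Measurable fun v : Fin n → X => v ∘ σ :=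
        measurable_pi_lambda _ fun i => measurable_pi_apply (σ i)
      have hsurj : MeasurableSet {v : Fin n → X | ∀ j, ∃ i, v (σ i) = v j} := by
        simp only [ofPred_forall, ofPred_exists]
        exact .iInter fun j => .iUnion fun i =>
          measurableSet_eq_fun (measurable_pi_apply _) (measurable_pi_apply _)
      exact (hcomp (EnumCode.measurableSet_describes hφm (fun k => (hF k).1) (e m))).inter hsurj
    refine measurable_find (fun v : Fin n → X => hQ' (Finset.univ.image v)) fun m => ?_
    have hnone : MeasurableSet {v : Fin n → X | ∀ m, ¬ Q (Finset.univ.image v) m} := by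
      simp only [ofPred_forall]
      exact .iInter fun k => (hQm k).compl
    exact (hQm m).union hnone
  · have hex (S : Finset X) (hS : ∀ x ∈ S, ∀ y ∈ S, E x y) : Q S (Nat.find (hQ' S)) := by
      refine (Nat.find_spec (hQ' S)).resolve_right fun hno => ?_
      let w : Fin S.card → X := fun i => S.equivFin.symm i
      have hw : Injective w := Subtype.val_injective.comp S.equivFin.symm.injective
      obtain ⟨N, s, k, hc⟩ := EnumCode.exists_describes hφ (F := F) hw fun i j =>
        hEF (hS _ (S.equivFin.symm i).2 _ (S.equivFin.symm j).2)
      obtain ⟨m, hm⟩ := he ⟨_, N, s, k⟩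
      refine hno m ?_
      dsimp only [Q]
      rw [hm]
      refine ⟨w, hc, ?_⟩
      change range (Subtype.val ∘ S.equivFin.symm) = _
      rw [S.equivFin.symm.surjective.range_comp]
      simp
    have hS' := hex S hS
    have hT' := hex T hT
    simp only at hD
    rw [← hD] at hT'
    obtain ⟨w, hw, hwS⟩ := hS'
    obtain ⟨w', hw', hwT⟩ := hT'
    obtain ⟨x, hx⟩ := hne
    rw [Finset.mem_inter, ← Finset.mem_coe, ← Finset.mem_coe, ← hwS, ← hwT] at hx
    obtain ⟨⟨i, hi⟩, ⟨i', hi'⟩⟩ := hx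
    obtain rfl := hw.eq (fun k => (hF k).2) hw' (hi.trans hi'.symm)
    exact Finset.coe_injective (hwS.symm.trans hwT)
end

section
/- Let M be a linearly ordered set and c : M → M → ℕ a proper edge ℕ-coloring of the complete graph on M. For each k ∈ ℕ let U_k := {x ∈ M | ∃ z, x < z and c x z = k}. Then the family (U_k)_{k ∈ ℕ} separates points of M: for all distinct x, y ∈ M there is k such that exactly one of x, y belongs to U_k. -/
/-- From a linear order and a proper edge `ℕ`-coloring of the complete graph, the sets
`U k = {x | ∃ z > x, c x z = k}` form a countable family separating points. -/
theorem stmt_10 {M : Type*} [LinearOrder M] (c : M → M → ℕ)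
    (hsymm : ∀ x y : M, x ≠ y → c x y = c y x)
    (hproper : ∀ x y x' y' : M, x ≠ y → x' ≠ y' → ({x, y} : Set M) ≠ {x', y'} →
      (({x, y} : Set M) ∩ {x', y'}).Nonempty → c x y ≠ c x' y')
    (U : ℕ → Set M)
    (hU : ∀ k, U k = {x : M | ∃ z, x < z ∧ c x z = k}) :
    ∀ x y : M, x ≠ y → ∃ k, Xor' (x ∈ U k) (y ∈ U k) := by
  have key : ∀ x y : M, x < y → x ∈ U (c x y) ∧ y ∉ U (c x y) := by
    intro x y hxy
    rw [hU]
    refine ⟨⟨y, hxy, rfl⟩, ?_⟩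
    rintro ⟨z, hyz, hz⟩
    refine hproper y z x y hyz.ne hxy.ne (fun h => ?_) ⟨y, by simp, by simp⟩ hz
    have hmem : z ∈ ({x, y} : Set M) := h ▸ by simp
    rcases hmem with rfl | rfl
    · exact lt_asymm hxy hyz
    · exact lt_irrefl _ hyz
  intro x y hne
  rcases lt_or_gt_of_ne hne with h | h
  · exact ⟨c x y, Or.inl (key x y h)⟩
  · exact ⟨c y x, Or.inr (key y x h)⟩
end

section
/- Let M be a set with at least 3 elements and c : Finset M → ℕ a function such that any two distinct intersecting subsets of M, each of cardinality 2 or 3, receive different c-values (i.e., if S ≠ T, S ∩ T ≠ ∅, and both S and T have cardinality 2 or 3, then c S ≠ c T). For i, j ∈ ℕ define U_{ij} := {x ∈ M | ∃ z z', z ≠ x, z' ∉ {x, z}, c {x, z} = i, and c {x, z, z'} = j}. Then the family (U_{ij})_{i,j ∈ ℕ} separates points of M: for all distinct x, y ∈ M there are i, j such that exactly one of x, y belongs to U_{ij}. -/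
/-- A proper `ℕ`-coloring of the subsets of size 2 or 3 of a set with at least 3 elements
yields a countable family of subsets separating points. -/
theorem stmt_11 {M : Type*} [DecidableEq M]
    (h3 : ∃ x y z : M, x ≠ y ∧ x ≠ z ∧ y ≠ z)
    (c : Finset M → ℕ)
    (hc : ∀ S T : Finset M, S ≠ T → (S ∩ T).Nonempty →
      (S.card = 2 ∨ S.card = 3) → (T.card = 2 ∨ T.card = 3) → c S ≠ c T)
    (U : ℕ → ℕ → Set M)
    (hU : ∀ i j, U i j = {x : M | ∃ z z' : M, z ≠ x ∧ z' ≠ x ∧ z' ≠ z ∧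
      c {x, z} = i ∧ c {x, z, z'} = j}) :
    ∀ x y : M, x ≠ y → ∃ i j, Xor' (x ∈ U i j) (y ∈ U i j) := by
  intro x y hxy
  obtain ⟨z, hzx, hzy⟩ : ∃ z : M, z ≠ x ∧ z ≠ y := by
    obtain ⟨a, b, d, hab, had, hbd⟩ := h3
    by_contra! h
    have ha := or_iff_not_imp_left.2 (h a)
    have hb := or_iff_not_imp_left.2 (h b)
    have hd := or_iff_not_imp_left.2 (h d)
    grind
  refine ⟨c {x, z}, c {x, z, y}, Or.inl ⟨?_, ?_⟩⟩
  · rw [hU]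
    exact ⟨z, y, hzx, hxy.symm, hzy.symm, rfl, rfl⟩
  · rw [hU]
    rintro ⟨w, w', hwy, hw'y, hw'w, hi, hj⟩
    have htriple : ({y, w, w'} : Finset M) = {x, z, y} := by
      by_contra hne
      exact hc _ _ hne ⟨y, by simp⟩
        (Or.inr (Finset.card_eq_three.2 ⟨y, w, w', hwy.symm, hw'y.symm, hw'w.symm, rfl⟩))
        (Or.inr (Finset.card_eq_three.2 ⟨x, z, y, hzx.symm, hxy, hzy, rfl⟩)) hj
    have hw : w = x ∨ w = z := by
      have : w ∈ ({x, z, y} : Finset M) := htriple ▸ by simp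
      simpa [hwy] using this
    have hpair : ({y, w} : Finset M) ≠ {x, z} := fun h => by
      have : y ∈ ({x, z} : Finset M) := h ▸ by simp
      simp [hxy.symm, hzy.symm] at this
    exact hc _ _ hpair ⟨w, by simpa using hw⟩
      (Or.inl (Finset.card_pair hwy.symm)) (Or.inl (Finset.card_pair hzx.symm)) hi
end

section
/- Let M be a set, G a symmetric irreflexive relation on M such that every x ∈ M has only finitely many G-neighbors, and (U_i)_{i ∈ ℕ} a family of subsets of M separating points. For x, y with G x y, let i(x, y) be the least i ∈ ℕ such that exactly one of x, y belongs to U_i, and define A(x) := { i(x, y) | y is a G-neighbor of x and x ∈ U_{i(x,y)} }, a finite subset of ℕ. Then G x y implies A(x) ≠ A(y); hence x ↦ A(x) is a proper coloring of the graph G with values in the countable set of finite subsets of ℕ. -/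
/-- The combinatorial core of the Kechris–Solecki–Todorcevic coloring theorem: from a
countable separating family on the vertices of a locally finite graph, the assignment
`x ↦ A x` of finite subsets of `ℕ` is a proper coloring. -/
theorem stmt_12 {M : Type*} (G : M → M → Prop)
    (hsym : Symmetric G) (hirr : Irreflexive G)
    (hlf : ∀ x : M, {y : M | G x y}.Finite)
    (U : ℕ → Set M)
    (hU : ∀ x y : M, x ≠ y → ∃ k, Xor' (x ∈ U k) (y ∈ U k))
    (ix : M → M → ℕ)
    (hix : ∀ x y : M, G x y →
      Xor' (x ∈ U (ix x y)) (y ∈ U (ix x y)) ∧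
      ∀ m < ix x y, ¬ Xor' (x ∈ U m) (y ∈ U m))
    (A : M → Set ℕ)
    (hA : ∀ x : M, A x = {n | ∃ y : M, G x y ∧ ix x y = n ∧ x ∈ U n}) :
    (∀ x : M, (A x).Finite) ∧ ∀ x y : M, G x y → A x ≠ A y := by
  have symm_ix : ∀ x y, G x y → ix y x = ix x y := fun x y h => by
    obtain ⟨hxy, hxy_min⟩ := hix x y h
    obtain ⟨hyx, hyx_min⟩ := hix y x (hsym h)
    rcases lt_trichotomy (ix y x) (ix x y) with hlt | heq | hgt
    · exact (hxy_min _ hlt hyx.symm).elim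
    · exact heq
    · exact (hyx_min _ hgt hxy.symm).elim
  refine ⟨fun x => ?_, fun x y h heq => ?_⟩
  · rw [hA]
    refine ((hlf x).image (ix x)).subset ?_
    rintro n ⟨y, hy, hn, -⟩
    exact ⟨y, hy, hn⟩
  · rcases (hix x y h).1 with ⟨hx, hy⟩ | ⟨hy, hx⟩
    · have hmem : ix x y ∈ A x := by
        rw [hA]
        exact ⟨y, h, rfl, hx⟩
      rw [heq, hA] at hmem
      obtain ⟨-, -, -, hmem⟩ := hmem
      exact hy hmem
    · have hmem : ix x y ∈ A y := by
        rw [hA]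
        exact ⟨x, hsym h, symm_ix x y h, hy⟩
      rw [← heq, hA] at hmem
      obtain ⟨-, -, -, hmem⟩ := hmem
      exact hx hmem
end

section
/- Let X be a standard Borel space and G a symmetric irreflexive relation on X such that {p : X × X | G p.1 p.2} is Borel and every x ∈ X has only finitely many G-neighbors (G is a locally finite Borel graph). Then there exists a Borel function C : X → ℕ such that C x ≠ C y whenever G x y. (Kechris–Solecki–Todorcevic: every locally finite Borel graph admits a Borel ℕ-coloring.) -/
/-- A sequence of sets is Novikov separable if its members can be enlarged to measurable sets
with empty intersection. -/
def NovikovSeparable {X : Type*} [MeasurableSpace X] (S : ℕ → Set X) : Prop :=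
  ∃ B : ℕ → Set X, (∀ n, MeasurableSet (B n)) ∧ (∀ n, S n ⊆ B n) ∧ ⋂ n, B n = ∅

theorem NovikovSeparable.of_subset_iUnion {X : Type*} [MeasurableSpace X] {S : ℕ → Set X}
    {T : ℕ → ℕ → Set X} (i : ℕ) (hT : ∀ a, NovikovSeparable (T a))
    (hi : S i ⊆ ⋃ a, T a i) (hne : ∀ a n, n ≠ i → S n ⊆ T a n) : NovikovSeparable S := by
  choose B hBm hBT hB using hT
  refine ⟨fun n => if n = i then ⋃ a, B a n else ⋂ a, B a n, fun n => ?_, fun n => ?_, ?_⟩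
  · dsimp only
    split_ifs
    · exact MeasurableSet.iUnion fun a => hBm a n
    · exact MeasurableSet.iInter fun a => hBm a n
  · dsimp only
    split_ifs with h
    · subst h
      exact hi.trans (Set.iUnion_mono fun a => hBT a n)
    · exact Set.subset_iInter fun a => (hne a n h).trans (hBT a n)
  · refine Set.eq_empty_of_forall_notMem fun x hx => ?_
    rw [Set.mem_iInter] at hx
    have hxi := hx i
    rw [if_pos rfl, Set.mem_iUnion] at hxi
    obtain ⟨a, ha⟩ := hxi
    have hmem : x ∈ ⋂ n, B a n := by
      refine Set.mem_iInter.2 fun n => ?_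
      by_cases h : n = i
      · exact h ▸ ha
      · have hxn := hx n
        rw [if_neg h] at hxn
        exact Set.mem_iInter.1 hxn a
    rw [hB a] at hmem
    exact hmem

theorem NovikovSeparable.of_disjoint {X : Type*} [MeasurableSpace X] {S : ℕ → Set X} {i j : ℕ}
    (hij : i ≠ j) {U V : Set X} (hU : MeasurableSet U) (hV : MeasurableSet V)
    (hUV : Disjoint U V) (hi : S i ⊆ U) (hj : S j ⊆ V) : NovikovSeparable S := by
  refine ⟨fun n => if n = i then U else if n = j then V else Set.univ, fun n => ?_, fun n => ?_, ?_⟩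
  · dsimp only
    split_ifs
    exacts [hU, hV, MeasurableSet.univ]
  · dsimp only
    split_ifs with h h'
    exacts [h ▸ hi, h' ▸ hj, Set.subset_univ _]
  · refine Set.eq_empty_of_forall_notMem fun x hx => ?_
    rw [Set.mem_iInter] at hx
    have hxi := hx i
    have hxj := hx j
    rw [if_pos rfl] at hxi
    rw [if_neg hij.symm, if_pos rfl] at hxj
    exact Set.disjoint_left.1 hUV hxi hxj

/-- The image under `f n` of the cylinder prescribed by those among the first `k` values of `y`
that code coordinates of the `n`-th point. -/
def cylinderImage {X : Type*} (f : ℕ → (ℕ → ℕ) → X) (y : ℕ → ℕ) (k n : ℕ) : Set X :=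
  f n '' {z | ∀ m, Nat.pair n m < k → z m = y (Nat.pair n m)}

theorem cylinderImage_congr {X : Type*} (f : ℕ → (ℕ → ℕ) → X) {y y' : ℕ → ℕ} {k : ℕ}
    (h : ∀ i < k, y i = y' i) : cylinderImage f y k = cylinderImage f y' k := by
  funext n
  unfold cylinderImage
  congr 1
  ext z
  exact forall_congr' fun m => forall_congr' fun hm => by rw [h _ hm]

theorem exists_not_novikovSeparable_update {X : Type*} [MeasurableSpace X]
    (f : ℕ → (ℕ → ℕ) → X) (y : ℕ → ℕ) (k : ℕ) (h : ¬ NovikovSeparable (cylinderImage f y k)) :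
    ∃ a, ¬ NovikovSeparable (cylinderImage f (Function.update y k a) (k + 1)) := by
  by_contra! hs
  refine h (NovikovSeparable.of_subset_iUnion (Nat.unpair k).1 hs ?_ ?_)
  · rintro _ ⟨z, hz, rfl⟩
    refine Set.mem_iUnion.2 ⟨z (Nat.unpair k).2, z, fun m hm => ?_, rfl⟩
    by_cases hk : Nat.pair (Nat.unpair k).1 m = k
    · have : m = (Nat.unpair k).2 := by
        conv_rhs => rw [← hk, Nat.unpair_pair]
      rw [hk, Function.update_self, this]
    · rw [Function.update_of_ne hk]
      exact hz m (by omega)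
  · rintro a n hn _ ⟨z, hz, rfl⟩
    refine ⟨z, fun m hm => ?_, rfl⟩
    have hk : Nat.pair n m ≠ k := by
      rintro rfl
      exact hn (by rw [Nat.unpair_pair])
    rw [Function.update_of_ne hk]
    exact hz m (by omega)

theorem exists_forall_not_novikovSeparable {X : Type*} [MeasurableSpace X]
    (f : ℕ → (ℕ → ℕ) → X) (h : ¬ NovikovSeparable fun n => Set.range (f n)) :
    ∃ y, ∀ k, ¬ NovikovSeparable (cylinderImage f y k) := by
  have h0 : ¬ NovikovSeparable (cylinderImage f 0 0) := by
    have : cylinderImage f 0 0 = fun n => Set.range (f n) := by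
      funext n
      simp [cylinderImage]
    rwa [this]
  choose a ha using exists_not_novikovSeparable_update f
  let Y : (k : ℕ) → {y : ℕ → ℕ // ¬ NovikovSeparable (cylinderImage f y k)} := fun k =>
    Nat.rec ⟨0, h0⟩ (fun k y => ⟨Function.update y.1 k (a y.1 k y.2), ha y.1 k y.2⟩) k
  have hstep : ∀ k i, i ≠ k → (Y (k + 1)).1 i = (Y k).1 i := fun k i hi =>
    Function.update_of_ne hi _ _
  have hstable : ∀ i k, i + 1 ≤ k → (Y k).1 i = (Y (i + 1)).1 i := by
    intro i k hk
    induction k, hk using Nat.le_induction with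
    | base => rfl
    | succ k hk ih => rw [hstep k i (by omega), ih]
  refine ⟨fun i => (Y (i + 1)).1 i, fun k => ?_⟩
  rw [cylinderImage_congr f fun i hi => (hstable i k hi).symm]
  exact (Y k).2

theorem exists_cylinderImage_subset {X : Type*} [TopologicalSpace X] {f : ℕ → (ℕ → ℕ) → X} {n : ℕ}
    (hf : Continuous (f n)) (y : ℕ → ℕ) {U : Set X} (hU : IsOpen U)
    (hy : f n (fun m => y (Nat.pair n m)) ∈ U) :
    ∃ K, ∀ k ≥ K, cylinderImage f y k n ⊆ U := by
  obtain ⟨I, u, hu, hIu⟩ := isOpen_pi_iff.1 (hU.preimage hf) _ hy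
  refine ⟨I.sup (fun m => Nat.pair n m + 1), ?_⟩
  rintro k hk _ ⟨z, hz, rfl⟩
  refine hIu fun m hm => ?_
  have : Nat.pair n m + 1 ≤ I.sup (fun m => Nat.pair n m + 1) :=
    Finset.le_sup (f := fun m => Nat.pair n m + 1) hm
  rw [hz m (by omega)]
  exact (hu m hm).2

/-- **Novikov's separation theorem**: a sequence of analytic sets with empty intersection can be
enlarged to a sequence of measurable sets with empty intersection. -/
theorem novikovSeparable_of_analyticSet {X : Type*} [TopologicalSpace X] [T2Space X]
    [MeasurableSpace X] [OpensMeasurableSpace X] {S : ℕ → Set X}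
    (hS : ∀ n, MeasureTheory.AnalyticSet (S n)) (hempty : ⋂ n, S n = ∅) :
    NovikovSeparable S := by
  by_cases hn : ∃ n, S n = ∅
  · obtain ⟨n, hn⟩ := hn
    exact NovikovSeparable.of_disjoint (Nat.succ_ne_self n).symm MeasurableSet.empty
      MeasurableSet.univ (Set.empty_disjoint _) hn.subset (Set.subset_univ _)
  push Not at hn
  have hf : ∀ n, ∃ f : (ℕ → ℕ) → X, Continuous f ∧ Set.range f = S n := fun n => by
    have h := hS n
    rw [MeasureTheory.AnalyticSet] at h
    exact h.resolve_left (hn n).ne_empty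
  choose f hfc hfS using hf
  obtain rfl : (fun n => Set.range (f n)) = S := funext hfS
  by_contra hsep
  obtain ⟨y, hy⟩ := exists_forall_not_novikovSeparable f hsep
  let p : ℕ → X := fun n => f n fun m => y (Nat.pair n m)
  by_cases hp : ∀ n, p n = p 0
  · have hmem : p 0 ∈ ⋂ n, Set.range (f n) := Set.mem_iInter.2 fun n => ⟨_, hp n⟩
    rw [hempty] at hmem
    exact hmem
  · push Not at hp
    obtain ⟨n, hn⟩ := hp
    obtain ⟨U, V, hU, hV, hpU, hpV, hUV⟩ := t2_separation hn
    obtain ⟨K, hK⟩ := exists_cylinderImage_subset (hfc n) y hU hpU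
    obtain ⟨L, hL⟩ := exists_cylinderImage_subset (hfc 0) y hV hpV
    have hn0 : n ≠ 0 := fun h => hn (by rw [h])
    exact hy (max K L) (NovikovSeparable.of_disjoint hn0 hU.measurableSet hV.measurableSet hUV
      (hK _ (le_max_left _ _)) (hL _ (le_max_right _ _)))

/-- **Kechris–Solecki–Todorcevic**: every locally finite Borel graph on a standard Borel
space admits a Borel `ℕ`-coloring. -/
theorem stmt_13 {X : Type*} [MeasurableSpace X] [StandardBorelSpace X]
    (G : X → X → Prop) (hsym : Symmetric G) (hirr : Irreflexive G)
    (hBorel : MeasurableSet {p : X × X | G p.1 p.2})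
    (hlf : ∀ x : X, {y : X | G x y}.Finite) :
    ∃ C : X → ℕ, Measurable C ∧ ∀ x y : X, G x y → C x ≠ C y := by
  classical
  let _ := upgradeStandardBorel X
  obtain ⟨b, hbc, -, hb⟩ := TopologicalSpace.exists_countable_basis X
  cases isEmpty_or_nonempty X
  · exact ⟨fun _ => 0, measurable_const, fun x => isEmptyElim x⟩
  obtain ⟨v, hv, -⟩ :=
    hb.exists_subset_of_mem_open (Set.mem_univ (Classical.arbitrary X)) isOpen_univ
  obtain ⟨U, hbU⟩ := hbc.exists_eq_range ⟨v, hv⟩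
  have hUm : ∀ n, MeasurableSet (U n) := fun n =>
    (hb.isOpen (hbU ▸ Set.mem_range_self n)).measurableSet
  let S : ℕ → Set X := fun n =>
    Prod.fst '' {p : X × X | p.1 ∉ U n ∨ (G p.1 p.2 ∧ p.2 ∈ U n)}
  have hS : ∀ n, MeasureTheory.AnalyticSet (S n) := fun n =>
    (((hUm n).compl.preimage measurable_fst).union
      (hBorel.inter ((hUm n).preimage measurable_snd))).analyticSet.image_of_continuous
        continuous_fst
  have hempty : ⋂ n, S n = ∅ := by
    refine Set.eq_empty_of_forall_notMem fun x hx => ?_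
    obtain ⟨u, hu, hxu, hsub⟩ := hb.exists_subset_of_mem_open
      (show x ∈ {y | G x y}ᶜ from hirr x) (hlf x).isClosed.isOpen_compl
    rw [hbU] at hu
    obtain ⟨n, rfl⟩ := hu
    obtain ⟨⟨x', y⟩, hp, rfl⟩ := Set.mem_iInter.1 hx n
    rcases hp with hp | ⟨hG, hy⟩
    · exact hp hxu
    · exact hsub hy hG
  obtain ⟨B, hBm, hSB, hB⟩ := novikovSeparable_of_analyticSet hS hempty
  have hex : ∀ x, ∃ n, x ∉ B n := fun x => by
    by_contra! h
    have hmem : x ∈ ⋂ n, B n := Set.mem_iInter.2 h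
    rw [hB] at hmem
    exact hmem
  refine ⟨fun x => Nat.find (hex x), measurable_find hex fun n => (hBm n).compl, ?_⟩
  intro x y hG hC
  have hx := Nat.find_spec (hex x)
  have hy := Nat.find_spec (hex y)
  simp only at hC
  rw [← hC] at hy
  set n := Nat.find (hex x)
  have hyU : y ∈ U n := by
    by_contra h
    exact hy (hSB n ⟨(y, y), Or.inl h, rfl⟩)
  exact hx (hSB n ⟨(x, y), Or.inr ⟨hG, hyU⟩, rfl⟩)
end
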